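/- arXiv:2007.07034 — 3 statements merged into one kernel-verified Lean document; each statement's English description precedes it below -/
import Mathlib

section
/- For every dimension n ≥ 2 there is a constant C = C(n) > 0 with the following property: let {D_j} be a collection of closed unit balls in ℝⁿ whose pairwise distances are at least 100, let R > 100, and let h be a real-valued harmonic function on B_R ∖ ⋃_j D_j which does not change sign on each set B_R ∩ (5D_j ∖ D_j). Then ∫_{B_R ∖ (B_{R/2} ∪ ⋃_j 3D_j)} h² ≥ exp(−C·R·log R) · ∫_{B_{R/2} ∖ ⋃_j 3D_j} h². -/
noncomputable section

open MeasureTheory Metric Filter Set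
open scoped Topology ENNReal RealInnerProductSpace

/-- The Euclidean plane. -/
abbrev E2 : Type := EuclideanSpace ℝ (Fin 2)

/-- The Laplacian of a function on `ℝⁿ`, computed via iterated Fréchet derivatives in the
coordinate directions. -/
def lap {n : ℕ} (f : EuclideanSpace ℝ (Fin n) → ℝ) (x : EuclideanSpace ℝ (Fin n)) : ℝ :=
  ∑ i : Fin n, fderiv ℝ (fun y => fderiv ℝ f y (EuclideanSpace.single i 1)) x
    (EuclideanSpace.single i 1)

/-- A test function on a set `Ω`: smooth, compactly supported, with support inside `Ω`. -/
def IsTestFun {n : ℕ} (Ω : Set (EuclideanSpace ℝ (Fin n)))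
    (h : EuclideanSpace ℝ (Fin n) → ℝ) : Prop :=
  ContDiff ℝ (⊤ : ℕ∞) h ∧ HasCompactSupport h ∧ tsupport h ⊆ Ω

/-- `u` is a weak solution of `Δu + Vu = 0` on `Ω`:
`∫_Ω u Δh + ∫_Ω V u h = 0` for every test function `h` on `Ω`. -/
def IsWeakSol {n : ℕ} (Ω : Set (EuclideanSpace ℝ (Fin n)))
    (V u : EuclideanSpace ℝ (Fin n) → ℝ) : Prop :=
  ∀ h, IsTestFun Ω h →
    (∫ x in Ω, u x * lap h x) + (∫ x in Ω, V x * u x * h x) = 0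

/-- The supremum of `|u|` over a set `s`. -/
def supAbs {n : ℕ} (u : EuclideanSpace ℝ (Fin n) → ℝ) (s : Set (EuclideanSpace ℝ (Fin n))) : ℝ :=
  sSup ((fun z => |u z|) '' s)

/-- A family of closed unit balls (given by their centers) is `L`-separated if any two distinct
balls of the family are at distance at least `L` from each other. -/
def UnitBallsSeparated {n : ℕ} {ι : Type} (c : ι → EuclideanSpace ℝ (Fin n)) (L : ℝ) : Prop :=
  ∀ i j, i ≠ j → ∀ x ∈ closedBall (c i) 1, ∀ y ∈ closedBall (c j) 1, L ≤ dist x y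

/-- `u` is harmonic at every point of `s` (for `s` open this is usual harmonicity on `s`). -/
def HarmonicOnSet {n : ℕ} (u : EuclideanSpace ℝ (Fin n) → ℝ)
    (s : Set (EuclideanSpace ℝ (Fin n))) : Prop :=
  ∀ x ∈ s, ContDiffAt ℝ 2 u x ∧ lap u x = 0

/-- `u` does not change sign on `s`. -/
def NoSignChange {n : ℕ} (u : EuclideanSpace ℝ (Fin n) → ℝ)
    (s : Set (EuclideanSpace ℝ (Fin n))) : Prop :=
  (∀ x ∈ s, 0 ≤ u x) ∨ (∀ x ∈ s, u x ≤ 0)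

/-- The partial derivative of `f` in the `i`-th coordinate direction. -/
def pd {n : ℕ} (i : Fin n) (f : EuclideanSpace ℝ (Fin n) → ℝ) (x : EuclideanSpace ℝ (Fin n)) : ℝ :=
  fderiv ℝ f x (EuclideanSpace.single i 1)

section Calculus

variable {n : ℕ} {f g : EuclideanSpace ℝ (Fin n) → ℝ} {i : Fin n} {x : EuclideanSpace ℝ (Fin n)}

lemma lap_eq_sum_pd : lap f x = ∑ i, pd i (pd i f) x := rfl

lemma pd_mul (hf : DifferentiableAt ℝ f x) (hg : DifferentiableAt ℝ g x) :
    pd i (fun y => f y * g y) x = pd i f x * g x + f x * pd i g x := by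
  simp only [pd, fderiv_fun_mul hf hg]
  simp
  ring

lemma pd_add (hf : DifferentiableAt ℝ f x) (hg : DifferentiableAt ℝ g x) :
    pd i (fun y => f y + g y) x = pd i f x + pd i g x := by
  simp [pd, fderiv_fun_add hf hg]

lemma pd_sub (hf : DifferentiableAt ℝ f x) (hg : DifferentiableAt ℝ g x) :
    pd i (fun y => f y - g y) x = pd i f x - pd i g x := by
  simp [pd, fderiv_fun_sub hf hg]

lemma pd_congr (h : f =ᶠ[𝓝 x] g) : pd i f x = pd i g x := by
  simp only [pd, h.fderiv_eq]

lemma pd_eventuallyEq (h : f =ᶠ[𝓝 x] g) : pd i f =ᶠ[𝓝 x] pd i g := by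
  filter_upwards [h.eventuallyEq_nhds] with y hy using pd_congr hy

lemma lap_congr (h : f =ᶠ[𝓝 x] g) : lap f x = lap g x := by
  simp only [lap_eq_sum_pd]
  exact Finset.sum_congr rfl fun i _ => pd_congr (pd_eventuallyEq h)

@[simp] lemma pd_const (a : ℝ) : pd i (fun _ => a) x = 0 := by simp [pd]

@[simp] lemma lap_const (a : ℝ) : lap (fun _ => a) x = 0 := by
  simp only [lap_eq_sum_pd]
  refine Finset.sum_eq_zero fun i _ => ?_
  have : pd i (fun _ : EuclideanSpace ℝ (Fin n) => a) = fun _ => 0 := by ext; simp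
  rw [this, pd_const]

lemma contDiffAt_pd (hf : ContDiffAt ℝ 2 f x) : ContDiffAt ℝ 1 (pd i f) x := by
  have : ContDiffAt ℝ 1 (fderiv ℝ f) x := hf.fderiv_right (by norm_num)
  exact this.clm_apply contDiffAt_const

lemma contDiff_pd (hf : ContDiff ℝ 2 f) : ContDiff ℝ 1 (pd i f) :=
  contDiff_iff_contDiffAt.2 fun _ => contDiffAt_pd hf.contDiffAt

lemma continuous_pd (hf : ContDiff ℝ 1 f) : Continuous (pd i f) :=
  (hf.continuous_fderiv (by norm_num)).clm_apply continuous_const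

lemma continuous_lap (hf : ContDiff ℝ 2 f) : Continuous (lap f) :=
  continuous_finsetSum _ fun _ _ => continuous_pd (contDiff_pd hf)

lemma lap_mul (hf : ContDiffAt ℝ 2 f x) (hg : ContDiffAt ℝ 2 g x) :
    lap (fun y => f y * g y) x = f x * lap g x + 2 * ∑ i, pd i f x * pd i g x + lap f x * g x := by
  simp only [lap_eq_sum_pd, Finset.mul_sum, Finset.sum_mul, ← Finset.sum_add_distrib]
  refine Finset.sum_congr rfl fun i _ => ?_
  have h1 : pd i (fun y => f y * g y) =ᶠ[𝓝 x] fun y => pd i f y * g y + f y * pd i g y := by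
    filter_upwards [hf.eventually (by norm_num), hg.eventually (by norm_num)] with y hy hy'
    exact pd_mul (hy.differentiableAt (by norm_num)) (hy'.differentiableAt (by norm_num))
  have df := hf.differentiableAt (by norm_num)
  have dg := hg.differentiableAt (by norm_num)
  have df' := (contDiffAt_pd (i := i) hf).differentiableAt (by norm_num)
  have dg' := (contDiffAt_pd (i := i) hg).differentiableAt (by norm_num)
  rw [pd_congr h1, pd_add (df'.fun_mul dg) (df.fun_mul dg'), pd_mul df' dg, pd_mul df dg']
  ring

lemma lap_sub (hf : ContDiffAt ℝ 2 f x) (hg : ContDiffAt ℝ 2 g x) :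
    lap (fun y => f y - g y) x = lap f x - lap g x := by
  simp only [lap_eq_sum_pd, ← Finset.sum_sub_distrib]
  refine Finset.sum_congr rfl fun i _ => ?_
  have h1 : pd i (fun y => f y - g y) =ᶠ[𝓝 x] fun y => pd i f y - pd i g y := by
    filter_upwards [hf.eventually (by norm_num), hg.eventually (by norm_num)] with y hy hy'
    exact pd_sub (hy.differentiableAt (by norm_num)) (hy'.differentiableAt (by norm_num))
  have df' := (contDiffAt_pd (i := i) hf).differentiableAt (by norm_num)
  have dg' := (contDiffAt_pd (i := i) hg).differentiableAt (by norm_num)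
  rw [pd_congr h1, pd_sub df' dg']

lemma pd_comm (i j : Fin n) (hf : ContDiff ℝ 2 f) : pd i (pd j f) x = pd j (pd i f) x := by
  have h := (hf.contDiffAt (x := x)).isSymmSndFDerivAt (by simp)
  have key (k l : Fin n) : pd k (pd l f) x =
      fderiv ℝ (fderiv ℝ f) x (EuclideanSpace.single k 1) (EuclideanSpace.single l 1) := by
    have hd : DifferentiableAt ℝ (fderiv ℝ f) x :=
      (hf.fderiv_right (m := 1) (by norm_num)).differentiable (by norm_num) x
    unfold pd
    rw [fderiv_clm_apply hd (by fun_prop)]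
    simp
  rw [key, key]
  exact h _ _

lemma hasCompactSupport_pd (hf : HasCompactSupport f) : HasCompactSupport (pd i f) :=
  hf.fderiv_apply ℝ (EuclideanSpace.single i 1)

lemma lap_eq_zero_of_notMem (h : x ∉ tsupport f) : lap f x = 0 := by
  rw [lap_congr (notMem_tsupport_iff_eventuallyEq.1 h)]
  exact lap_const 0

lemma hasCompactSupport_lap (hf : HasCompactSupport f) : HasCompactSupport (lap f) :=
  hf.of_isClosed_subset (isClosed_tsupport _) <| closure_minimal (fun _ hx => by
    by_contra h
    exact hx (lap_eq_zero_of_notMem h)) (isClosed_tsupport _)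

lemma integral_mul_pd (hf : ContDiff ℝ 1 f) (hg : ContDiff ℝ 1 g) (hc : HasCompactSupport g) :
    ∫ x, f x * pd i g x = -∫ x, pd i f x * g x := by
  have h1 := hf.continuous
  have h2 := hg.continuous
  have h3 := continuous_pd (i := i) hf
  have h4 := continuous_pd (i := i) hg
  exact integral_mul_fderiv_eq_neg_fderiv_mul_of_integrable
    ((h3.mul h2).integrable_of_hasCompactSupport hc.mul_left)
    ((h1.mul h4).integrable_of_hasCompactSupport (hasCompactSupport_pd hc).mul_left)
    ((h1.mul h2).integrable_of_hasCompactSupport hc.mul_left)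
    (fun x _ => hf.differentiable (by norm_num) x) (fun x _ => hg.differentiable (by norm_num) x)

lemma integral_mul_lap (hf : ContDiff ℝ 2 f) (hg : ContDiff ℝ 2 g) (hc : HasCompactSupport g) :
    ∫ x, g x * lap f x = ∫ x, f x * lap g x := by
  simp only [lap_eq_sum_pd, Finset.mul_sum]
  have hf1 := hf.of_le (m := 1) (by norm_num)
  have hg1 := hg.of_le (m := 1) (by norm_num)
  rw [integral_finsetSum, integral_finsetSum]
  · refine Finset.sum_congr rfl fun i _ => ?_
    have e1 := integral_mul_pd (i := i) hf1 (contDiff_pd (i := i) hg) (hasCompactSupport_pd hc)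
    have e2 := integral_mul_pd (i := i) (contDiff_pd (i := i) hf) hg1 hc
    rw [e1, e2, neg_neg]
    simp only [mul_comm]
  · exact fun i _ =>
      (hf.continuous.mul (continuous_pd (contDiff_pd hg))).integrable_of_hasCompactSupport
      (hasCompactSupport_pd (hasCompactSupport_pd hc)).mul_left
  · exact fun i _ =>
      (hg.continuous.mul (continuous_pd (contDiff_pd hf))).integrable_of_hasCompactSupport
      hc.mul_right

/-- Caccioppoli's inequality, as an identity. -/
lemma integral_mul_sum_sq_pd (hf : ContDiff ℝ 2 f) (hg : ContDiff ℝ 2 g) (hc : HasCompactSupport g)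
    (h0 : ∀ x, g x ≠ 0 → lap f x = 0) :
    ∫ x, g x * ∑ i, pd i f x ^ 2 = 2⁻¹ * ∫ x, f x ^ 2 * lap g x := by
  rw [← integral_mul_lap (hf.pow 2) hg hc, ← integral_const_mul]
  refine integral_congr_ae (.of_forall fun x => ?_)
  by_cases hx : g x = 0
  · simp [hx]
  · have := lap_mul (x := x) hf.contDiffAt hf.contDiffAt
    simp only [h0 x hx, ← sq] at this
    simp only [this]
    ring

end Calculus

section Carleman

variable {n : ℕ} {u v : EuclideanSpace ℝ (Fin n) → ℝ} {j : Fin n}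

lemma hasCompactSupport_sq (hc : HasCompactSupport v) : HasCompactSupport (fun x => v x ^ 2) := by
  have : (fun x => v x ^ 2) = v * v := funext fun x => sq _
  rw [this]
  exact hc.mul_left

lemma integral_pd_mul_self (hv : ContDiff ℝ 1 v) (hc : HasCompactSupport v) :
    ∫ x, v x * pd j v x = 0 := by
  have := integral_mul_pd (i := j) hv hv hc
  simp only [mul_comm (pd j v _)] at this
  linarith

lemma integral_lap_mul_pd (hv : ContDiff ℝ 2 v) (hc : HasCompactSupport v) :
    ∫ x, lap v x * pd j v x = 0 := by
  simp only [lap_eq_sum_pd, Finset.sum_mul]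
  have hi (i : Fin n) : Integrable (fun x => pd i (pd i v) x * pd j v x) :=
    ((continuous_pd (contDiff_pd hv)).mul (continuous_pd (hv.of_le (by norm_num)))
      ).integrable_of_hasCompactSupport (hasCompactSupport_pd hc).mul_left
  rw [integral_finsetSum _ fun i _ => hi i]
  refine Finset.sum_eq_zero fun i _ => ?_
  have e1 := integral_mul_pd (i := i) (contDiff_pd (i := i) hv) (contDiff_pd (i := j) hv)
    (hasCompactSupport_pd hc)
  simp only [pd_comm i j hv] at e1
  rw [integral_pd_mul_self (contDiff_pd hv) (hasCompactSupport_pd hc)] at e1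
  linarith

lemma pd_coord (x : EuclideanSpace ℝ (Fin n)) :
    pd j (fun y : EuclideanSpace ℝ (Fin n) => y j) x = 1 := by
  have : (fun y : EuclideanSpace ℝ (Fin n) => y j) = EuclideanSpace.proj (𝕜 := ℝ) j := rfl
  rw [pd, this, ContinuousLinearMap.fderiv]
  simp

lemma contDiff_coord {m : WithTop ℕ∞} : ContDiff ℝ m (fun y : EuclideanSpace ℝ (Fin n) => y j) :=
  (EuclideanSpace.proj (𝕜 := ℝ) j).contDiff

/-- Poincaré's inequality in a slab. -/
lemma integral_sq_le_integral_sq_pd (hv : ContDiff ℝ 1 v) (hc : HasCompactSupport v) {R : ℝ}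
    (hR : ∀ x, v x ≠ 0 → |x j| ≤ R) :
    ∫ x, v x ^ 2 ≤ 4 * R ^ 2 * ∫ x, pd j v x ^ 2 := by
  have hv2 : HasCompactSupport (fun x => v x ^ 2) := hasCompactSupport_sq hc
  have hp := continuous_pd (i := j) hv
  have e := integral_mul_pd (i := j) (contDiff_coord (j := j)) (hv.pow 2) hv2
  simp only [pd_coord, one_mul] at e
  have hi1 : Integrable (fun x => v x ^ 2) :=
    (hv.continuous.pow 2).integrable_of_hasCompactSupport hv2
  have hi2 : Integrable (fun x => pd j v x ^ 2) := by
    exact (hp.pow 2).integrable_of_hasCompactSupport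
      (hasCompactSupport_sq (hasCompactSupport_pd hc))
  have e2 : ∀ x, -(x j * pd j (fun y => v y ^ 2) x) ≤ 2⁻¹ * v x ^ 2 + 2 * R ^ 2 * pd j v x ^ 2 := by
    intro x
    have hd := hv.differentiable (by norm_num) x
    have : pd j (fun y => v y ^ 2) x = 2 * v x * pd j v x := by
      simp only [sq, pd_mul hd hd]; ring
    rw [this]
    by_cases hx : v x = 0
    · simp only [hx]; nlinarith [sq_nonneg (R * pd j v x)]
    · have h1 : (x j) ^ 2 ≤ R ^ 2 := sq_le_sq' (by linarith [(abs_le.1 (hR x hx)).1])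
        (abs_le.1 (hR x hx)).2
      nlinarith [sq_nonneg (v x + 2 * (x j * pd j v x)),
        mul_le_mul_of_nonneg_right h1 (sq_nonneg (pd j v x))]
  have hi3 : Integrable (fun x => x j * pd j (fun y => v y ^ 2) x) :=
    ((contDiff_coord (j := j) (m := 0)).continuous.mul (continuous_pd (hv.pow 2))
      ).integrable_of_hasCompactSupport (hasCompactSupport_pd hv2).mul_left
  have := integral_mono hi3.neg ((hi1.const_mul 2⁻¹).add (hi2.const_mul (2 * R ^ 2))) e2
  simp only [Pi.add_apply, Pi.neg_apply] at this
  rw [integral_neg, e, integral_add (hi1.const_mul 2⁻¹) (hi2.const_mul (2 * R ^ 2)),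
    integral_const_mul, integral_const_mul] at this
  linarith

/-- A Carleman inequality with linear weight. -/
lemma carleman (hu : ContDiff ℝ 2 u) (hc : HasCompactSupport u) {R k : ℝ} (hk : 0 < k)
    (hR : ∀ x, u x ≠ 0 → |x j| ≤ R) :
    ∫ x, u x ^ 2 * Real.exp (2 * k * x j) ≤
      R ^ 2 / k ^ 2 * ∫ x, lap u x ^ 2 * Real.exp (2 * k * x j) := by
  set w : EuclideanSpace ℝ (Fin n) → ℝ := fun x => Real.exp (k * x j) with hw
  have hw2 : ∀ x, Real.exp (2 * k * x j) = w x ^ 2 := fun x => by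
    rw [hw, ← Real.exp_nat_mul]; congr 1; push_cast; ring
  have hwc {m : WithTop ℕ∞} : ContDiff ℝ m w := (contDiff_const.mul contDiff_coord).exp
  have hpw (i : Fin n) : pd i w = fun x => (if i = j then k else 0) * w x := by
    ext x
    have h1 : HasFDerivAt w (w x • (k • (EuclideanSpace.proj (𝕜 := ℝ) j :
        EuclideanSpace ℝ (Fin n) →L[ℝ] ℝ))) x :=
      (((EuclideanSpace.proj (𝕜 := ℝ) j : EuclideanSpace ℝ (Fin n) →L[ℝ] ℝ).hasFDerivAt
        (x := x)).const_mul k).exp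
    rw [pd, h1.fderiv]
    simp [eq_comm]
    split_ifs <;> ring
  set v : EuclideanSpace ℝ (Fin n) → ℝ := fun x => w x * u x with hv
  have hvc : ContDiff ℝ 2 v := hwc.mul hu
  have hvs : HasCompactSupport v := hc.mul_left
  have hlw : ∀ x, lap w x = k ^ 2 * w x := by
    intro x
    rw [lap_eq_sum_pd, Finset.sum_eq_single j]
    · have hwd : DifferentiableAt ℝ w x := (hwc (m := 1)).differentiable (by norm_num) x
      rw [hpw]
      simp only [if_true]
      rw [pd_mul (by fun_prop) hwd, hpw]
      simp; ring
    · intro i _ hi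
      rw [hpw]; simp [hi]
    · simp
  have hpv : ∀ x, pd j v x = w x * (pd j u x + k * u x) := by
    intro x
    rw [hv, pd_mul ((hwc (m := 1)).differentiable (by norm_num) x)
      (hu.differentiable (by norm_num) x), hpw]
    simp; ring
  have hlv : ∀ x, w x * lap u x = lap v x - 2 * k * pd j v x + k ^ 2 * v x := by
    intro x
    rw [hpv, hv, lap_mul hwc.contDiffAt hu.contDiffAt, hlw]
    simp only [hpw, ite_mul, zero_mul, Finset.sum_ite_eq', Finset.mem_univ, if_true]
    ring
  have cv := hvc.continuous
  have cp := continuous_pd (i := j) (hvc.of_le (m := 1) (by norm_num))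
  have cl := continuous_lap hvc
  have hps := hasCompactSupport_pd (i := j) hvs
  have i1 : Integrable (fun x => lap v x * pd j v x) :=
    (cl.mul cp).integrable_of_hasCompactSupport hps.mul_left
  have i2 : Integrable (fun x => pd j v x ^ 2) := by
    exact (cp.pow 2).integrable_of_hasCompactSupport (hasCompactSupport_sq hps)
  have i3 : Integrable (fun x => v x * pd j v x) :=
    (cv.mul cp).integrable_of_hasCompactSupport hps.mul_left
  have i4 : Integrable (fun x => lap u x ^ 2 * w x ^ 2) := by
    refine (((continuous_lap hu).pow 2).mul
      ((hwc (m := 0)).continuous.pow 2)).integrable_of_hasCompactSupport ?_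
    have := (hasCompactSupport_lap hc).mul_left (f := lap u)
    simpa only [sq] using this.mul_right
  have e1 : ∫ x, w x * lap u x * pd j v x = -(2 * k) * ∫ x, pd j v x ^ 2 := by
    have : (fun x => w x * lap u x * pd j v x) = fun x => lap v x * pd j v x +
        (-(2 * k) * pd j v x ^ 2 + k ^ 2 * (v x * pd j v x)) := by
      ext x; rw [hlv]; ring
    rw [this, integral_add i1 (by fun_prop), integral_add (by fun_prop) (by fun_prop),
      integral_const_mul, integral_const_mul, integral_lap_mul_pd hvc hvs,
      integral_pd_mul_self (hvc.of_le (by norm_num)) hvs]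
    ring
  have e2 : k * ∫ x, pd j v x ^ 2 ≤ (4 * k)⁻¹ * ∫ x, lap u x ^ 2 * w x ^ 2 := by
    have i5 : Integrable (fun x => w x * lap u x * pd j v x) :=
      (((hwc (m := 0)).continuous.mul (continuous_lap hu)).mul cp).integrable_of_hasCompactSupport
        hps.mul_left
    have := integral_mono i5.neg ((i4.const_mul (4 * k)⁻¹).add (i2.const_mul k)) (fun x => by
      have h3 : 0 ≤ (4 * k)⁻¹ * (w x * lap u x + 2 * k * pd j v x) ^ 2 := by positivity
      have h4 : (4 * k)⁻¹ * (w x * lap u x + 2 * k * pd j v x) ^ 2 =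
        (4 * k)⁻¹ * (lap u x ^ 2 * w x ^ 2) + k * pd j v x ^ 2 + w x * lap u x * pd j v x := by
        field_simp; ring
      simp only [Pi.neg_apply, Pi.add_apply]
      linarith)
    simp only [Pi.add_apply, Pi.neg_apply] at this
    rw [integral_neg, e1, integral_add (i4.const_mul _) (i2.const_mul k), integral_const_mul,
      integral_const_mul] at this
    linarith
  have e3 := integral_sq_le_integral_sq_pd (j := j) (hvc.of_le (m := 1) (by norm_num)) hvs (R := R)
    (fun x hx => hR x (right_ne_zero_of_mul hx))
  simp only [hw2]
  have e4 : ∫ x, u x ^ 2 * w x ^ 2 = ∫ x, v x ^ 2 :=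
    integral_congr_ae (.of_forall fun x => by simp only [hv]; ring)
  rw [e4]
  have e5 : ∫ x, pd j v x ^ 2 ≤ (4 * k ^ 2)⁻¹ * ∫ x, lap u x ^ 2 * w x ^ 2 := by
    have := mul_le_mul_of_nonneg_left e2 (inv_nonneg.2 hk.le)
    rw [← mul_assoc, inv_mul_cancel₀ hk.ne', one_mul, ← mul_assoc, ← mul_inv] at this
    rwa [show (4 * k ^ 2)⁻¹ = (k * (4 * k))⁻¹ by ring]
  calc _ ≤ _ := e3
    _ ≤ 4 * R ^ 2 * ((4 * k ^ 2)⁻¹ * ∫ x, lap u x ^ 2 * w x ^ 2) := by gcongr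
    _ = _ := by field_simp

end Carleman

section Harnack

variable {n : ℕ} {f u : EuclideanSpace ℝ (Fin n) → ℝ}

lemma fderiv_eq_sum_pd (x y : EuclideanSpace ℝ (Fin n)) :
    fderiv ℝ f x y = ∑ i, y i * pd i f x := by
  conv_lhs => rw [← (EuclideanSpace.basisFun (Fin n) ℝ).sum_repr y]
  simp [pd]

/-- The radial kernel `(r² - |y|²)₊` of the weighted mean value property. -/
def meanKernel (r : ℝ) (y : EuclideanSpace ℝ (Fin n)) : ℝ := max (r ^ 2 - ‖y‖ ^ 2) 0

lemma meanKernel_nonneg (r : ℝ) (y : EuclideanSpace ℝ (Fin n)) : 0 ≤ meanKernel r y :=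
  le_max_right _ _

lemma meanKernel_eq_zero {r : ℝ} {y : EuclideanSpace ℝ (Fin n)} (hr : 0 < r) (hy : r ≤ ‖y‖) :
    meanKernel r y = 0 :=
  max_eq_right (by nlinarith [norm_nonneg y])

lemma continuous_meanKernel (r : ℝ) :
    Continuous (meanKernel r : EuclideanSpace ℝ (Fin n) → ℝ) := by
  unfold meanKernel; fun_prop

lemma hasCompactSupport_meanKernel {r : ℝ} (hr : 0 < r) :
    HasCompactSupport (meanKernel r : EuclideanSpace ℝ (Fin n) → ℝ) :=
  HasCompactSupport.intro (isCompact_closedBall 0 r) fun y hy =>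
    meanKernel_eq_zero hr (by simpa using (not_le.1 (by simpa using hy)).le)

lemma integrable_mul_meanKernel {g : EuclideanSpace ℝ (Fin n) → ℝ} (hg : Continuous g) {r : ℝ}
    (hr : 0 < r) (x : EuclideanSpace ℝ (Fin n)) :
    Integrable (fun y => g (x + y) * meanKernel r y) :=
  ((hg.comp (by fun_prop)).mul (continuous_meanKernel r)).integrable_of_hasCompactSupport
    (hasCompactSupport_meanKernel hr).mul_left

lemma hasDerivAt_max_zero_sq (s : ℝ) : HasDerivAt (fun s : ℝ => max s 0 ^ 2) (2 * max s 0) s := by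
  rcases lt_trichotomy s 0 with hs | rfl | hs
  · rw [max_eq_right hs.le, mul_zero]
    refine (hasDerivAt_const s (0 : ℝ)).congr_of_eventuallyEq ?_
    filter_upwards [Iio_mem_nhds hs] with t ht
    rw [max_eq_right (Set.mem_Iio.1 ht).le]
    norm_num
  · rw [hasDerivAt_iff_isLittleO_nhds_zero]
    have : (fun h : ℝ => max (0 + h) 0 ^ 2 - max 0 0 ^ 2 - h • (2 * max (0 : ℝ) 0)) =O[𝓝 0]
        fun h : ℝ => h ^ 2 := by
      refine Asymptotics.IsBigO.of_bound 1 (.of_forall fun h => ?_)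
      simp only [zero_add, max_self, Real.norm_eq_abs, one_mul]
      rcases le_total h 0 with hh | hh
      · simp [max_eq_right hh, sq_nonneg]
      · simp [max_eq_left hh]
    exact this.trans_isLittleO (by simpa using Asymptotics.isLittleO_pow_id (𝕜 := ℝ) one_lt_two)
  · rw [max_eq_left hs.le]
    refine (by simpa using hasDerivAt_pow 2 s : HasDerivAt (fun s : ℝ => s ^ 2) (2 * s) s)
      |>.congr_of_eventuallyEq ?_
    filter_upwards [Ioi_mem_nhds hs] with t ht
    rw [max_eq_left (Set.mem_Ioi.1 ht).le]

lemma hasFDerivAt_meanKernel_sq (r : ℝ) (y : EuclideanSpace ℝ (Fin n)) :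
    HasFDerivAt (fun y : EuclideanSpace ℝ (Fin n) => meanKernel r y ^ 2)
      ((-4 * meanKernel r y) • innerSL ℝ y) y := by
  have h1 : HasFDerivAt (fun y : EuclideanSpace ℝ (Fin n) => r ^ 2 - ‖y‖ ^ 2)
      (-(2 • innerSL ℝ y)) y := (hasStrictFDerivAt_norm_sq y).hasFDerivAt.const_sub _
  have := (hasDerivAt_max_zero_sq (r ^ 2 - ‖y‖ ^ 2)).comp_hasFDerivAt y h1
  refine this.congr_fderiv ?_
  ext z
  simp [meanKernel]
  ring

lemma contDiff_meanKernel_sq (r : ℝ) :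
    ContDiff ℝ 1 (fun y : EuclideanSpace ℝ (Fin n) => meanKernel r y ^ 2) := by
  rw [contDiff_one_iff_fderiv]
  refine ⟨fun y => (hasFDerivAt_meanKernel_sq r y).differentiableAt, ?_⟩
  have : fderiv ℝ (fun y : EuclideanSpace ℝ (Fin n) => meanKernel r y ^ 2) =
      fun y => (-4 * meanKernel r y) • innerSL ℝ y :=
    funext fun y => (hasFDerivAt_meanKernel_sq r y).fderiv
  rw [this]
  exact (continuous_const.mul (continuous_meanKernel r)).smul (innerSL ℝ).continuous

lemma pd_meanKernel_sq (r : ℝ) (i : Fin n) (y : EuclideanSpace ℝ (Fin n)) :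
    pd i (fun y => meanKernel r y ^ 2) y = -4 * (y i * meanKernel r y) := by
  rw [pd, (hasFDerivAt_meanKernel_sq r y).fderiv]
  simp [EuclideanSpace.inner_single_right]
  ring

lemma integral_fderiv_mul_meanKernel {r : ℝ} (hr : 0 < r) {x : EuclideanSpace ℝ (Fin n)}
    (hf : ContDiff ℝ 2 f) (hh : ∀ y ∈ ball x r, lap f y = 0) {t : ℝ} (ht0 : 0 ≤ t) (ht1 : t ≤ 1) :
    ∫ y, fderiv ℝ f (x + t • y) y * meanKernel r y = 0 := by
  have hcs : HasCompactSupport fun y : EuclideanSpace ℝ (Fin n) => meanKernel r y ^ 2 :=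
    hasCompactSupport_sq (hasCompactSupport_meanKernel hr)
  have hg (i : Fin n) : ContDiff ℝ 1 fun y => pd i f (x + t • y) :=
    (contDiff_pd hf).comp (contDiff_const.add (contDiff_id.const_smul t))
  have hpg (i : Fin n) (y) : pd i (fun y => pd i f (x + t • y)) y =
      t * pd i (pd i f) (x + t • y) := by
    have h1 : HasFDerivAt (fun y : EuclideanSpace ℝ (Fin n) => x + t • y)
      (t • ContinuousLinearMap.id ℝ _) y := ((hasFDerivAt_id y).const_smul t).const_add x
    have h2 := ((contDiff_pd (i := i) hf).differentiable (by norm_num) (x + t • y)).hasFDerivAt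
    have h3 := HasFDerivAt.comp (g := pd i f) (f := fun y => x + t • y) y h2 h1
    rw [Function.comp_def] at h3
    rw [pd, h3.fderiv]
    simp [pd]
  have e (i : Fin n) := integral_mul_pd (i := i) (hg i) (contDiff_meanKernel_sq r) hcs
  simp only [hpg, pd_meanKernel_sq] at e
  have hi (i : Fin n) :
      Integrable fun y : EuclideanSpace ℝ (Fin n) => pd i f (x + t • y) * (y i * meanKernel r y) :=
    ((hg i).continuous.mul ((contDiff_coord (m := 0)).continuous.mul
      (continuous_meanKernel r))).integrable_of_hasCompactSupport
      (hasCompactSupport_meanKernel hr).mul_left.mul_left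
  have hi' (i : Fin n) : Integrable fun y : EuclideanSpace ℝ (Fin n) =>
      t * pd i (pd i f) (x + t • y) * meanKernel r y ^ 2 := by
    refine ((continuous_const.mul ((continuous_pd (contDiff_pd hf)).comp (by fun_prop))).mul
      ((continuous_meanKernel r).pow 2)).integrable_of_hasCompactSupport hcs.mul_left
  have e1 : (fun y => fderiv ℝ f (x + t • y) y * meanKernel r y) =
      fun y => ∑ i, pd i f (x + t • y) * (y i * meanKernel r y) := by
    ext y
    rw [fderiv_eq_sum_pd, Finset.sum_mul]
    exact Finset.sum_congr rfl fun i _ => by ring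
  have e2 : ∑ i, ∫ y, t * pd i (pd i f) (x + t • y) * meanKernel r y ^ 2 = 0 := by
    rw [← integral_finsetSum _ fun i _ => hi' i]
    refine integral_eq_zero_of_ae (.of_forall fun y => ?_)
    simp only [← Finset.sum_mul, ← Finset.mul_sum, ← lap_eq_sum_pd, Pi.zero_apply]
    by_cases hy : ‖y‖ < r
    · rw [hh]
      · ring
      · simp only [mem_ball, dist_self_add_left, norm_smul, Real.norm_eq_abs, abs_of_nonneg ht0]
        nlinarith [norm_nonneg y]
    · rw [meanKernel_eq_zero hr (not_lt.1 hy)]; ring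
  rw [e1, integral_finsetSum _ fun i _ => hi i]
  have e3 (i : Fin n) : ∫ y, pd i f (x + t • y) * (y i * meanKernel r y) =
      4⁻¹ * ∫ y, t * pd i (pd i f) (x + t • y) * meanKernel r y ^ 2 := by
    have : ∫ y, pd i f (x + t • y) * (-4 * (y i * meanKernel r y)) =
        -4 * ∫ y, pd i f (x + t • y) * (y i * meanKernel r y) := by
      rw [← integral_const_mul]; congr 1; ext y; ring
    linarith [e i]
  simp only [e3, ← Finset.mul_sum, e2, mul_zero]

/-- The weighted mean value property of harmonic functions. -/
lemma integral_mul_meanKernel {r : ℝ} (hr : 0 < r) {x : EuclideanSpace ℝ (Fin n)}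
    (hf : ContDiff ℝ 2 f) (hh : ∀ y ∈ ball x r, lap f y = 0) :
    ∫ y, f (x + y) * meanKernel r y =
      f x * ∫ y : EuclideanSpace ℝ (Fin n), meanKernel r y := by
  have hfc := hf.continuous_fderiv (by norm_num)
  have hd (t : ℝ) : HasDerivAt (fun t : ℝ => ∫ y, f (x + t • y) * meanKernel r y)
      (∫ y, fderiv ℝ f (x + t • y) y * meanKernel r y) t := by
    obtain ⟨K, hK⟩ := (isCompact_closedBall x ((|t| + 1) * r)).exists_bound_of_continuousOn
      hfc.continuousOn
    refine (hasDerivAt_integral_of_dominated_loc_of_deriv_le (𝕜 := ℝ) (E := ℝ)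
      (F := fun t y => f (x + t • y) * meanKernel r y)
      (F' := fun t y => fderiv ℝ f (x + t • y) y * meanKernel r y)
      (bound := fun y => K * r * meanKernel r y)
      (ball_mem_nhds t one_pos) (.of_forall fun s => ?_) ?_ ?_ ?_ ?_ ?_).2
    · exact ((hf.continuous.comp (by fun_prop)).mul (continuous_meanKernel r)).aestronglyMeasurable
    · exact ((hf.continuous.comp (by fun_prop)).mul
        (continuous_meanKernel r)).integrable_of_hasCompactSupport
        (hasCompactSupport_meanKernel hr).mul_left
    · exact (((hfc.comp (f := fun y => x + t • y) (by fun_prop)).clm_apply continuous_id).mul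
        (continuous_meanKernel r)).aestronglyMeasurable
    · refine .of_forall fun y s hs => ?_
      by_cases hy : ‖y‖ < r
      · have hs' : |s| ≤ |t| + 1 := by
          have h1 : |s - t| < 1 := by simpa [Real.dist_eq] using hs
          have := abs_sub_abs_le_abs_sub s t
          linarith
        have h2 := hK (x + s • y) (by
          simp only [mem_closedBall, dist_self_add_left, norm_smul, Real.norm_eq_abs]
          gcongr)
        rw [norm_mul, Real.norm_of_nonneg (meanKernel_nonneg r y)]
        gcongr
        · exact meanKernel_nonneg r y
        · refine (ContinuousLinearMap.le_opNorm _ _).trans ?_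
          have := (norm_nonneg _).trans h2
          gcongr
      · simp [meanKernel_eq_zero hr (not_lt.1 hy)]
    · exact ((continuous_meanKernel r).integrable_of_hasCompactSupport
        (hasCompactSupport_meanKernel hr)).const_mul _
    · refine .of_forall fun y s _ => ?_
      have h1 : HasDerivAt (fun s : ℝ => x + s • y) y s := by
        simpa using ((hasDerivAt_id s).smul_const y).const_add x
      exact ((hf.differentiable (by norm_num) _).hasFDerivAt.comp_hasDerivAt s h1).mul_const _
  have := constant_of_has_deriv_right_zero (a := 0) (b := 1)
    (f := fun t : ℝ => ∫ y, f (x + t • y) * meanKernel r y)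
    (fun t _ => (hd t).continuousAt.continuousWithinAt)
    (fun t ht => by
      have := hd t
      rw [integral_fderiv_mul_meanKernel hr hf hh ht.1 ht.2.le] at this
      exact this.hasDerivWithinAt) 1 (by simp)
  simpa [integral_const_mul] using this

lemma integral_meanKernel_pos {r : ℝ} (hr : 0 < r) :
    0 < ∫ y : EuclideanSpace ℝ (Fin n), meanKernel r y := by
  refine (continuous_meanKernel r).integral_pos_of_hasCompactSupport_nonneg_nonzero
    (hasCompactSupport_meanKernel hr) (meanKernel_nonneg r) (x := 0) ?_
  have : 0 < r ^ 2 := by positivity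
  simp only [meanKernel, norm_zero]
  rw [max_eq_left (by linarith)]
  linarith

/-- Harnack's inequality on concentric balls. -/
lemma harnack_ball {r : ℝ} (hr : 0 < r) {x y : EuclideanSpace ℝ (Fin n)} (hu : ContDiff ℝ 2 u)
    (hh : ∀ z ∈ ball x (4 * r), lap u z = 0) (hp : ∀ z ∈ ball x (4 * r), 0 ≤ u z)
    (hy : dist y x < r) :
    u y ≤ (∫ z : EuclideanSpace ℝ (Fin n), meanKernel (4 * r) z) /
      (∫ z : EuclideanSpace ℝ (Fin n), meanKernel r z) * u x := by
  have hz := integral_meanKernel_pos (n := n) hr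
  have e1 := integral_mul_meanKernel (r := 4 * r) (by positivity) hu hh
  have hsub : ball y r ⊆ ball x (4 * r) := ball_subset_ball' (by linarith)
  have e2 := integral_mul_meanKernel hr hu fun z hz => hh z (hsub hz)
  have e3 : ∫ z, u (y + z) * meanKernel r z = ∫ z, u (x + z) * meanKernel r (z - (y - x)) := by
    rw [← integral_sub_right_eq_self (fun z => u (y + z) * meanKernel r z) (y - x)]
    congr 1; ext z; congr 2; abel
  rw [div_mul_eq_mul_div, le_div_iff₀ hz, ← e2, mul_comm _ (u x), ← e1, e3]
  refine integral_mono ?_ (integrable_mul_meanKernel hu.continuous (by positivity) x) fun z => ?_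
  · have := (integrable_mul_meanKernel hu.continuous hr y).comp_sub_right (y - x)
    refine this.congr (.of_forall fun z => ?_)
    simp only []
    congr 2; abel
  · by_cases h1 : ‖z - (y - x)‖ < r
    · have h2 : ‖y - x‖ < r := by rwa [← dist_eq_norm]
      have h3 : ‖z‖ < 2 * r := by
        have := norm_add_le (z - (y - x)) (y - x)
        rw [sub_add_cancel] at this
        linarith
      refine mul_le_mul_of_nonneg_left ?_ (hp _ (by simp; linarith))
      refine max_le_max ?_ le_rfl
      nlinarith [norm_nonneg z, norm_nonneg (z - (y - x))]
    · simp only [meanKernel_eq_zero hr (not_lt.1 h1), mul_zero]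
      by_cases h4 : ‖z‖ < 4 * r
      · exact mul_nonneg (hp _ (by simpa using h4)) (meanKernel_nonneg _ _)
      · rw [meanKernel_eq_zero (by positivity) (not_lt.1 h4), mul_zero]

lemma isPreconnected_shell (hn : 2 ≤ n) {a b : ℝ} (ha : 0 ≤ a) :
    IsPreconnected {x : EuclideanSpace ℝ (Fin n) | a < ‖x‖ ∧ ‖x‖ < b} := by
  have hs : IsPreconnected (sphere (0 : EuclideanSpace ℝ (Fin n)) 1) :=
    isPreconnected_sphere (by
      rw [← Module.finrank_eq_rank]
      simp only [finrank_euclideanSpace, Fintype.card_fin]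
      exact_mod_cast hn) 0 1
  have := (isPreconnected_Ioo (a := a) (b := b)).prod hs |>.image (fun p => p.1 • p.2) (by fun_prop)
  convert this using 1
  ext x
  simp only [mem_ofPred_eq, Set.mem_image, Set.mem_prod, Set.mem_Ioo, mem_sphere_iff_norm, sub_zero,
    Prod.exists]
  constructor
  · rintro ⟨h1, h2⟩
    have h0 : ‖x‖ ≠ 0 := by linarith
    exact ⟨‖x‖, ‖x‖⁻¹ • x, ⟨⟨h1, h2⟩, by simp [norm_smul, h0]⟩, by simp [smul_smul, h0]⟩
  · rintro ⟨t, y, ⟨⟨h1, h2⟩, h3⟩, rfl⟩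
    rw [norm_smul, h3, mul_one, Real.norm_of_nonneg (by linarith)]
    exact ⟨h1, h2⟩

/-- Harnack's inequality on compact subsets of a preconnected open set. -/
lemma exists_harnack {U K : Set (EuclideanSpace ℝ (Fin n))} (hU : IsOpen U)
    (hUc : IsPreconnected U) (hK : IsCompact K) (hKU : K ⊆ U) :
    ∃ C : ℝ, 0 ≤ C ∧ ∀ u : EuclideanSpace ℝ (Fin n) → ℝ, ContDiff ℝ 2 u →
      (∀ z ∈ U, lap u z = 0) → (∀ z ∈ U, 0 ≤ u z) → ∀ x ∈ K, ∀ y ∈ K, u x ≤ C * u y := by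
  have loc : ∀ x ∈ U, ∃ r > 0, ∃ C : ℝ, 0 ≤ C ∧ ball x r ⊆ U ∧
      ∀ u : EuclideanSpace ℝ (Fin n) → ℝ, ContDiff ℝ 2 u →
      (∀ z ∈ U, lap u z = 0) → (∀ z ∈ U, 0 ≤ u z) →
      ∀ y ∈ ball x r, u y ≤ C * u x ∧ u x ≤ C * u y := by
    intro x hx
    obtain ⟨ε, hε, hb⟩ := Metric.isOpen_iff.1 hU x hx
    refine ⟨ε / 5, by positivity, (∫ z : EuclideanSpace ℝ (Fin n), meanKernel (4 * (ε / 5)) z) /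
      (∫ z : EuclideanSpace ℝ (Fin n), meanKernel (ε / 5) z), ?_,
      (ball_subset_ball (by linarith)).trans hb,
      fun u hu hh hp y hy => ?_⟩
    · exact div_nonneg (integral_nonneg (meanKernel_nonneg _))
        (integral_nonneg (meanKernel_nonneg _))
    · have hr : 0 < ε / 5 := by positivity
      have h1 : ball x (4 * (ε / 5)) ⊆ U := (ball_subset_ball (by linarith)).trans hb
      have h2 : ball y (4 * (ε / 5)) ⊆ U :=
        (ball_subset_ball' (by linarith [mem_ball.1 hy])).trans hb
      exact ⟨harnack_ball hr hu (fun z hz => hh z (h1 hz)) (fun z hz => hp z (h1 hz)) hy,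
        harnack_ball hr hu (fun z hz => hh z (h2 hz)) (fun z hz => hp z (h2 hz))
          (by rwa [dist_comm])⟩
  have conn : ∀ x ∈ U, ∀ y ∈ U, ∃ C : ℝ, 0 ≤ C ∧ ∀ u : EuclideanSpace ℝ (Fin n) → ℝ,
      ContDiff ℝ 2 u → (∀ z ∈ U, lap u z = 0) → (∀ z ∈ U, 0 ≤ u z) → u x ≤ C * u y := by
    intro x hx y hy
    refine hUc.induction₂' (fun x y => ∃ C : ℝ, 0 ≤ C ∧ ∀ u : EuclideanSpace ℝ (Fin n) → ℝ,
      ContDiff ℝ 2 u → (∀ z ∈ U, lap u z = 0) → (∀ z ∈ U, 0 ≤ u z) → u x ≤ C * u y)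
      (fun x hx => ?_) ?_ hx hy
    · obtain ⟨r, hr, C, hC, -, h⟩ := loc x hx
      filter_upwards [mem_nhdsWithin_of_mem_nhds (ball_mem_nhds x hr)] with y hy
      exact ⟨⟨C, hC, fun u h1 h2 h3 => (h u h1 h2 h3 y hy).2⟩,
        ⟨C, hC, fun u h1 h2 h3 => (h u h1 h2 h3 y hy).1⟩⟩
    · rintro x y z - - - ⟨C, hC, h⟩ ⟨D, hD, h'⟩
      refine ⟨C * D, mul_nonneg hC hD, fun u h1 h2 h3 => (h u h1 h2 h3).trans ?_⟩
      rw [mul_assoc]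
      exact mul_le_mul_of_nonneg_left (h' u h1 h2 h3) hC
  rcases K.eq_empty_or_nonempty with rfl | ⟨b, hbK⟩
  · exact ⟨0, le_rfl, by simp⟩
  have main : ∃ C : ℝ, 0 ≤ C ∧ ∀ u : EuclideanSpace ℝ (Fin n) → ℝ, ContDiff ℝ 2 u →
      (∀ z ∈ U, lap u z = 0) → (∀ z ∈ U, 0 ≤ u z) → ∀ x ∈ K ∩ U, u x ≤ C * u b ∧ u b ≤ C * u x := by
    refine hK.induction_on (p := fun s => ∃ C : ℝ, 0 ≤ C ∧ ∀ u : EuclideanSpace ℝ (Fin n) → ℝ,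
      ContDiff ℝ 2 u → (∀ z ∈ U, lap u z = 0) → (∀ z ∈ U, 0 ≤ u z) →
      ∀ x ∈ s ∩ U, u x ≤ C * u b ∧ u b ≤ C * u x) ⟨0, le_rfl, by simp⟩ ?_ ?_ ?_
    · rintro s t hst ⟨C, hC, h⟩
      exact ⟨C, hC, fun u h1 h2 h3 x hx => h u h1 h2 h3 x ⟨hst hx.1, hx.2⟩⟩
    · rintro s t ⟨C, hC, h⟩ ⟨D, hD, h'⟩
      refine ⟨max C D, le_max_of_le_left hC, fun u h1 h2 h3 x hx => ?_⟩
      have hb := h3 b (hKU hbK)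
      have hx0 := h3 x hx.2
      rcases hx.1 with hs | ht
      · obtain ⟨h4, h5⟩ := h u h1 h2 h3 x ⟨hs, hx.2⟩
        exact ⟨h4.trans (by gcongr; exact le_max_left _ _),
          h5.trans (by gcongr; exact le_max_left _ _)⟩
      · obtain ⟨h4, h5⟩ := h' u h1 h2 h3 x ⟨ht, hx.2⟩
        exact ⟨h4.trans (by gcongr; exact le_max_right _ _),
          h5.trans (by gcongr; exact le_max_right _ _)⟩
    · intro x hx
      obtain ⟨r, hr, C, hC, -, h⟩ := loc x (hKU hx)
      obtain ⟨D, hD, h'⟩ := conn x (hKU hx) b (hKU hbK)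
      obtain ⟨D', hD', h''⟩ := conn b (hKU hbK) x (hKU hx)
      refine ⟨ball x r, mem_nhdsWithin_of_mem_nhds (ball_mem_nhds x hr), max (C * D) (D' * C),
        by positivity, fun u h1 h2 h3 y hy => ?_⟩
      obtain ⟨h4, h5⟩ := h u h1 h2 h3 y hy.1
      have h6 := h' u h1 h2 h3
      have h7 := h'' u h1 h2 h3
      have hb := h3 b (hKU hbK)
      have hy0 := h3 y hy.2
      constructor
      · calc u y ≤ C * u x := h4
          _ ≤ C * (D * u b) := by gcongr
          _ = (C * D) * u b := by ring
          _ ≤ _ := by gcongr; exact le_max_left _ _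
      · calc u b ≤ D' * u x := h7
          _ ≤ D' * (C * u y) := by gcongr
          _ = (D' * C) * u y := by ring
          _ ≤ _ := by gcongr; exact le_max_right _ _
  obtain ⟨C, hC, h⟩ := main
  refine ⟨C * C, by positivity, fun u h1 h2 h3 x hx y hy => ?_⟩
  calc u x ≤ C * u b := (h u h1 h2 h3 x ⟨hx, hKU hx⟩).1
    _ ≤ C * (C * u y) := by gcongr; exact (h u h1 h2 h3 y ⟨hy, hKU hy⟩).2
    _ = _ := by ring

end Harnack

section Cutoff

variable {n : ℕ} {f g : EuclideanSpace ℝ (Fin n) → ℝ} {i : Fin n} {K L : ℝ}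

lemma pd_comp_smul_sub (hg : Differentiable ℝ g) (t : ℝ) (p x : EuclideanSpace ℝ (Fin n)) :
    pd i (fun y => g (t • (y - p))) x = t * pd i g (t • (x - p)) := by
  have h1 : HasFDerivAt (fun y : EuclideanSpace ℝ (Fin n) => t • (y - p))
    (t • ContinuousLinearMap.id ℝ _) x := ((hasFDerivAt_id x).sub_const p).const_smul t
  have h3 := HasFDerivAt.comp (g := g) (f := fun y => t • (y - p)) x (hg _).hasFDerivAt h1
  rw [Function.comp_def] at h3
  rw [pd, h3.fderiv]
  simp [pd]

lemma lap_comp_smul_sub (hg : ContDiff ℝ 2 g) (t : ℝ) (p x : EuclideanSpace ℝ (Fin n)) :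
    lap (fun y => g (t • (y - p))) x = t ^ 2 * lap g (t • (x - p)) := by
  simp only [lap_eq_sum_pd, Finset.mul_sum]
  refine Finset.sum_congr rfl fun i _ => ?_
  have e : pd i (fun y => g (t • (y - p))) = fun x => t * pd i g (t • (x - p)) :=
    funext (pd_comp_smul_sub (hg.differentiable (by norm_num)) t p)
  have hd : Differentiable ℝ (pd i g) := (contDiff_pd hg).differentiable (by norm_num)
  have hm := pd_mul (i := i) (x := x) (f := fun _ => t) (g := fun x => pd i g (t • (x - p)))
    (by fun_prop) (hd.comp (by fun_prop) x)
  rw [e, hm, pd_const, pd_comp_smul_sub hd]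
  ring

/-- `f` is a `C²` cutoff function with first derivatives and Laplacian bounded by `K`. -/
structure IsCutoff (K : ℝ) (f : EuclideanSpace ℝ (Fin n) → ℝ) : Prop where
  contDiff : ContDiff ℝ 2 f
  nonneg : ∀ x, 0 ≤ f x
  le_one : ∀ x, f x ≤ 1
  abs_pd_le : ∀ i x, |pd i f x| ≤ K
  abs_lap_le : ∀ x, |lap f x| ≤ K

lemma IsCutoff.bound_nonneg (hf : IsCutoff K f) : 0 ≤ K :=
  (abs_nonneg _).trans (hf.abs_lap_le 0)

lemma IsCutoff.one_sub (hf : IsCutoff K f) : IsCutoff K (fun x => 1 - f x) where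
  contDiff := contDiff_const.sub hf.contDiff
  nonneg x := by linarith [hf.le_one x]
  le_one x := by linarith [hf.nonneg x]
  abs_pd_le i x := by
    rw [pd_sub (by fun_prop) (hf.contDiff.differentiable (by norm_num) x), pd_const, zero_sub,
      abs_neg]
    exact hf.abs_pd_le i x
  abs_lap_le x := by
    rw [lap_sub contDiffAt_const hf.contDiff.contDiffAt, lap_const, zero_sub, abs_neg]
    exact hf.abs_lap_le x

lemma IsCutoff.mul (hf : IsCutoff K f) (hg : IsCutoff L g) :
    IsCutoff (K + L + 2 * (n * (K * L))) (fun x => f x * g x) where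
  contDiff := hf.contDiff.mul hg.contDiff
  nonneg x := mul_nonneg (hf.nonneg x) (hg.nonneg x)
  le_one x := mul_le_one₀ (hf.le_one x) (hg.nonneg x) (hg.le_one x)
  abs_pd_le i x := by
    have hK := hf.bound_nonneg
    have hL := hg.bound_nonneg
    rw [pd_mul (hf.contDiff.differentiable (by norm_num) x)
      (hg.contDiff.differentiable (by norm_num) x)]
    have h1 : |pd i f x * g x| ≤ K := by
      rw [abs_mul, abs_of_nonneg (hg.nonneg x)]
      exact (mul_le_of_le_one_right (abs_nonneg _) (hg.le_one x)).trans (hf.abs_pd_le i x)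
    have h2 : |f x * pd i g x| ≤ L := by
      rw [abs_mul, abs_of_nonneg (hf.nonneg x)]
      exact (mul_le_of_le_one_left (abs_nonneg _) (hf.le_one x)).trans (hg.abs_pd_le i x)
    have h3 : 0 ≤ 2 * (n * (K * L)) := by positivity
    linarith [abs_add_le (pd i f x * g x) (f x * pd i g x)]
  abs_lap_le x := by
    have hK := hf.bound_nonneg
    have hL := hg.bound_nonneg
    rw [lap_mul hf.contDiff.contDiffAt hg.contDiff.contDiffAt]
    have h1 : |lap f x * g x| ≤ K := by
      rw [abs_mul, abs_of_nonneg (hg.nonneg x)]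
      exact (mul_le_of_le_one_right (abs_nonneg _) (hg.le_one x)).trans (hf.abs_lap_le x)
    have h2 : |f x * lap g x| ≤ L := by
      rw [abs_mul, abs_of_nonneg (hf.nonneg x)]
      exact (mul_le_of_le_one_left (abs_nonneg _) (hf.le_one x)).trans (hg.abs_lap_le x)
    have h3 : |∑ i, pd i f x * pd i g x| ≤ n * (K * L) := by
      refine (Finset.abs_sum_le_sum_abs _ _).trans ?_
      refine (Finset.sum_le_card_nsmul _ _ (K * L) fun i _ => ?_).trans (by simp)
      rw [abs_mul]
      exact mul_le_mul (hf.abs_pd_le i x) (hg.abs_pd_le i x) (abs_nonneg _) hK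
    rw [abs_le] at *
    constructor <;> linarith

lemma IsCutoff.of_eventuallyEq (h : ∀ x, ∃ g, IsCutoff K g ∧ f =ᶠ[𝓝 x] g) : IsCutoff K f where
  contDiff := contDiff_iff_contDiffAt.2 fun x => by
    obtain ⟨g, hg, hfg⟩ := h x
    exact hg.contDiff.contDiffAt.congr_of_eventuallyEq hfg
  nonneg x := by
    obtain ⟨g, hg, hfg⟩ := h x
    exact hfg.eq_of_nhds ▸ hg.nonneg x
  le_one x := by
    obtain ⟨g, hg, hfg⟩ := h x
    exact hfg.eq_of_nhds ▸ hg.le_one x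
  abs_pd_le i x := by
    obtain ⟨g, hg, hfg⟩ := h x
    exact pd_congr hfg ▸ hg.abs_pd_le i x
  abs_lap_le x := by
    obtain ⟨g, hg, hfg⟩ := h x
    exact lap_congr hfg ▸ hg.abs_lap_le x

lemma exists_isCutoff_ball (n : ℕ) {a b : ℝ} (ha : 0 < a) (hab : a < b) :
    ∃ K : ℝ, ∀ (s : ℝ) (p : EuclideanSpace ℝ (Fin n)), 1 ≤ s → ∃ f, IsCutoff K f ∧
      (∀ x, dist x p ≤ a * s → f x = 1) ∧ ∀ x, b * s ≤ dist x p → f x = 0 := by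
  let φ : ContDiffBump (0 : EuclideanSpace ℝ (Fin n)) := ⟨a, b, ha, hab⟩
  have hφ : ContDiff ℝ 2 φ := φ.contDiff
  have hpd (i : Fin n) : ∃ K, ∀ x, ‖pd i φ x‖ ≤ K :=
    (hasCompactSupport_pd φ.hasCompactSupport).exists_bound_of_continuous
      (contDiff_pd hφ).continuous
  choose K hK using hpd
  obtain ⟨L, hL⟩ := (hasCompactSupport_lap φ.hasCompactSupport).exists_bound_of_continuous
    (continuous_lap hφ)
  have hK0 (i : Fin n) : 0 ≤ K i := (norm_nonneg _).trans (hK i 0)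
  have hL0 : 0 ≤ L := (norm_nonneg _).trans (hL 0)
  refine ⟨∑ i, K i + L, fun s p hs => ?_⟩
  have hs0 : 0 < s := by linarith
  have hs1 : s⁻¹ ≤ 1 := inv_le_one_of_one_le₀ hs
  have hs2 : 0 ≤ s⁻¹ := by positivity
  have hd (x) : dist (s⁻¹ • (x - p)) 0 = dist x p / s := by
    rw [dist_zero_right, norm_smul, Real.norm_of_nonneg hs2, dist_eq_norm]
    ring
  refine ⟨fun x => φ (s⁻¹ • (x - p)), ⟨hφ.comp (by fun_prop), fun _ => φ.nonneg, fun _ => φ.le_one,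
    fun i x => ?_, fun x => ?_⟩, fun x hx => ?_, fun x hx => ?_⟩
  · rw [pd_comp_smul_sub (hφ.differentiable (by norm_num)), abs_mul, abs_of_nonneg hs2]
    refine (mul_le_of_le_one_left (abs_nonneg _) hs1).trans ((hK i _).trans ?_)
    linarith [Finset.single_le_sum (fun i _ => hK0 i) (Finset.mem_univ i)]
  · rw [lap_comp_smul_sub hφ, abs_mul, abs_of_nonneg (by positivity)]
    refine (mul_le_of_le_one_left (abs_nonneg _) (pow_le_one₀ hs2 hs1)).trans ((hL _).trans ?_)
    linarith [Finset.sum_nonneg fun i (_ : i ∈ Finset.univ) => hK0 i]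
  · exact φ.one_of_mem_closedBall (by rwa [mem_closedBall, hd, div_le_iff₀ hs0])
  · exact φ.zero_of_le_dist (by rwa [hd, le_div_iff₀ hs0])

lemma exists_isCutoff_holes (n : ℕ) {a b : ℝ} (ha : 0 < a) (hab : a < b) (hb : b ≤ 4) :
    ∃ K : ℝ, ∀ T : Finset (EuclideanSpace ℝ (Fin n)),
      (∀ p ∈ T, ∀ q ∈ T, p ≠ q → 100 ≤ dist p q) → ∃ f, IsCutoff K f ∧
      (∀ x, ∀ p ∈ T, dist x p ≤ a → f x = 0) ∧ ∀ x, (∀ p ∈ T, b ≤ dist x p) → f x = 1 := by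
  obtain ⟨K, hK⟩ := exists_isCutoff_ball n ha hab
  choose φ hφ using fun p => hK 1 p le_rfl
  simp only [mul_one] at hφ
  have hK0 : 0 ≤ K := (hφ 0).1.bound_nonneg
  refine ⟨K, fun T hT => ?_⟩
  have near {p x} (hp : p ∈ T) (hx : dist x p ≤ 50) : ∑ q ∈ T, φ q x = φ p x := by
    refine Finset.sum_eq_single_of_mem p hp fun q hq hqp => (hφ q).2.2 x ?_
    have := hT p hp q hq hqp.symm
    linarith [dist_triangle_left p q x]
  refine ⟨fun x => 1 - ∑ p ∈ T, φ p x, .of_eventuallyEq fun x => ?_, fun x p hp hx => ?_,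
    fun x hx => ?_⟩
  · by_cases h : ∃ p ∈ T, dist x p < 50
    · obtain ⟨p, hp, hx⟩ := h
      refine ⟨_, (hφ p).1.one_sub, ?_⟩
      filter_upwards [isOpen_ball.mem_nhds (mem_ball.2 hx)] with y hy
      rw [near hp (mem_ball.1 hy).le]
    · push Not at h
      refine ⟨fun _ => 1, ⟨contDiff_const, by simp, by simp, by simp [hK0], by simp [hK0]⟩, ?_⟩
      filter_upwards [ball_mem_nhds x one_pos] with y hy
      rw [Finset.sum_eq_zero, sub_zero]
      intro p hp
      refine (hφ p).2.2 y ?_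
      linarith [h p hp, dist_triangle_left x p y, mem_ball.1 hy]
  · simp only []
    rw [near hp (by linarith), (hφ p).2.1 x hx, sub_self]
  · simp only []
    rw [Finset.sum_eq_zero fun p hp => (hφ p).2.2 x (hx p hp), sub_zero]

end Cutoff

section Energy

variable {n : ℕ} {f g H : EuclideanSpace ℝ (Fin n) → ℝ} {K : ℝ}

lemma caccioppoli_le (hH : ContDiff ℝ 2 H) (hg : IsCutoff K g)
    {A E : Set (EuclideanSpace ℝ (Fin n))}
    (hE : IsCompact E) (hgE : ∀ x ∉ E, g x = 0) (hHE : ∀ x ∈ E, lap H x = 0)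
    (hA : MeasurableSet A) (hgA : ∀ x ∈ A, g x = 1) :
    ∫ x in A, ∑ i, pd i H x ^ 2 ≤ K / 2 * ∫ x in E, H x ^ 2 := by
  have hc : HasCompactSupport g := HasCompactSupport.intro hE hgE
  have hS : Continuous fun x => ∑ i, pd i H x ^ 2 :=
    continuous_finsetSum _ fun i _ => (contDiff_pd hH).continuous.pow 2
  have hts : tsupport g ⊆ E := closure_minimal (fun x hx => by
    by_contra h
    exact hx (hgE x h)) hE.isClosed
  have e := integral_mul_sum_sq_pd hH hg.contDiff hc fun x hx => hHE x <| by
    by_contra h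
    exact hx (hgE x h)
  have hgi : Integrable fun x => g x * ∑ i, pd i H x ^ 2 :=
    (hg.contDiff.continuous.mul hS).integrable_of_hasCompactSupport hc.mul_right
  have hS0 (x) : 0 ≤ ∑ i, pd i H x ^ 2 := Finset.sum_nonneg fun i _ => sq_nonneg _
  calc ∫ x in A, ∑ i, pd i H x ^ 2 = ∫ x in A, g x * ∑ i, pd i H x ^ 2 :=
        setIntegral_congr_fun hA fun x hx => by simp [hgA x hx]
    _ ≤ ∫ x, g x * ∑ i, pd i H x ^ 2 :=
        setIntegral_le_integral hgi (.of_forall fun x => mul_nonneg (hg.nonneg x) (hS0 x))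
    _ = 2⁻¹ * ∫ x, H x ^ 2 * lap g x := e
    _ = 2⁻¹ * ∫ x in E, H x ^ 2 * lap g x := by
        rw [setIntegral_eq_integral_of_forall_compl_eq_zero]
        intro x hx
        rw [lap_eq_zero_of_notMem fun h => hx (hts h), mul_zero]
    _ ≤ 2⁻¹ * ∫ x in E, K * H x ^ 2 := by
        have h1 : Continuous fun x => H x ^ 2 * lap g x :=
          (hH.continuous.pow 2).mul (continuous_lap hg.contDiff)
        have h2 : Continuous fun x => K * H x ^ 2 := continuous_const.mul (hH.continuous.pow 2)
        refine mul_le_mul_of_nonneg_left (setIntegral_mono_on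
          (h1.continuousOn.integrableOn_compact hE) (h2.continuousOn.integrableOn_compact hE)
          hE.measurableSet fun x _ => ?_) (by norm_num)
        rw [mul_comm]
        exact mul_le_mul_of_nonneg_right ((le_abs_self _).trans (hg.abs_lap_le x)) (sq_nonneg _)
    _ = _ := by rw [integral_const_mul]; ring

lemma lap_mul_sq_le (hH : ContDiff ℝ 2 H) (hf : IsCutoff K f) {x : EuclideanSpace ℝ (Fin n)}
    (h : f x * lap H x = 0) :
    lap (fun y => f y * H y) x ^ 2 ≤
      (8 * (n * K ^ 2) + 2 * K ^ 2) * (∑ i, pd i H x ^ 2 + H x ^ 2) := by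
  rw [lap_mul hf.contDiff.contDiffAt hH.contDiffAt, h, zero_add]
  have h1 : (∑ i, pd i f x * pd i H x) ^ 2 ≤ (n * K ^ 2) * ∑ i, pd i H x ^ 2 := by
    refine (Finset.sum_mul_sq_le_sq_mul_sq _ _ _).trans ?_
    refine mul_le_mul_of_nonneg_right ?_ (Finset.sum_nonneg fun i _ => sq_nonneg _)
    refine (Finset.sum_le_card_nsmul _ _ (K ^ 2) fun i _ => ?_).trans (by simp)
    exact sq_le_sq' (abs_le.1 (hf.abs_pd_le i x)).1 (abs_le.1 (hf.abs_pd_le i x)).2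
  have h2 : (lap f x * H x) ^ 2 ≤ K ^ 2 * H x ^ 2 := by
    rw [mul_pow]
    gcongr ?_ * _
    exact sq_le_sq' (abs_le.1 (hf.abs_lap_le x)).1 (abs_le.1 (hf.abs_lap_le x)).2
  have h3 : 0 ≤ ∑ i, pd i H x ^ 2 := Finset.sum_nonneg fun i _ => sq_nonneg _
  have h4 : 0 ≤ K ^ 2 := sq_nonneg K
  have h5 : 0 ≤ (n : ℝ) * K ^ 2 := by positivity
  have h6 := sq_nonneg (2 * ∑ i, pd i f x * pd i H x - lap f x * H x)
  have h7 := mul_nonneg h5 (sq_nonneg (H x))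
  have h8 := mul_nonneg h4 h3
  nlinarith

lemma isCompact_shell (p : EuclideanSpace ℝ (Fin n)) (a b : ℝ) :
    IsCompact {x | a ≤ dist x p ∧ dist x p ≤ b} := by
  have h1 : IsClosed {x : EuclideanSpace ℝ (Fin n) | a ≤ dist x p} :=
    isClosed_le continuous_const (by fun_prop)
  exact (isCompact_closedBall p b).inter_left h1

lemma exists_shell_harnack (hn : 2 ≤ n) (j : Fin n) :
    ∃ C : ℝ, 0 ≤ C ∧ ∀ (p : EuclideanSpace ℝ (Fin n)) (H : EuclideanSpace ℝ (Fin n) → ℝ),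
      ContDiff ℝ 2 H → (∀ x, 2 < dist x p → dist x p < 5 → lap H x = 0) →
      ((∀ x, 2 < dist x p → dist x p < 5 → 0 ≤ H x) ∨
        (∀ x, 2 < dist x p → dist x p < 5 → H x ≤ 0)) →
      ∫ x in {x | 3 ≤ dist x p ∧ dist x p ≤ 4}, H x ^ 2 ≤
        C * ∫ x in closedBall (p + EuclideanSpace.single j (9 / 2)) (3 / 10), H x ^ 2 := by
  have hU : IsOpen {x : EuclideanSpace ℝ (Fin n) | 2 < ‖x‖ ∧ ‖x‖ < 5} :=
    (isOpen_lt continuous_const continuous_norm).inter (isOpen_lt continuous_norm continuous_const)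
  have hK : IsCompact {x : EuclideanSpace ℝ (Fin n) | 3 ≤ ‖x‖ ∧ ‖x‖ ≤ 24 / 5} :=
    by simpa using isCompact_shell (0 : EuclideanSpace ℝ (Fin n)) 3 (24 / 5)
  obtain ⟨C, hC, hh⟩ := exists_harnack hU (isPreconnected_shell hn (by norm_num)) hK
    fun x hx => ⟨by linarith [hx.1], by linarith [hx.2]⟩
  set V : ℝ := volume.real (closedBall (0 : EuclideanSpace ℝ (Fin n)) 4) with hV
  set W : ℝ := volume.real (closedBall (0 : EuclideanSpace ℝ (Fin n)) (3 / 10)) with hW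
  have hW0 : 0 < W := by
    rw [hW, Measure.real, ENNReal.toReal_pos_iff]
    exact ⟨measure_closedBall_pos _ _ (by norm_num), measure_closedBall_lt_top⟩
  refine ⟨V * C ^ 2 / W, by positivity, fun p H hH hlap hsign => ?_⟩
  set E := {x | 3 ≤ dist x p ∧ dist x p ≤ 4}
  set B := closedBall (p + EuclideanSpace.single j (9 / 2)) (3 / 10)
  have hEc : IsCompact E := isCompact_shell p 3 4
  have habs : ∀ x, 3 ≤ dist x p → dist x p ≤ 24 / 5 → ∀ y, 3 ≤ dist y p → dist y p ≤ 24 / 5 →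
      H x ^ 2 ≤ C ^ 2 * H y ^ 2 := by
    intro x hx1 hx2 y hy1 hy2
    have key (G : EuclideanSpace ℝ (Fin n) → ℝ) (hG : ContDiff ℝ 2 G)
        (hl : ∀ x, 2 < dist x p → dist x p < 5 → lap G x = 0)
        (hp : ∀ x, 2 < dist x p → dist x p < 5 → 0 ≤ G x) : G x ^ 2 ≤ C ^ 2 * G y ^ 2 := by
      have h1 := hh (fun z => G ((1 : ℝ) • (z - (-p)))) (hG.comp (by fun_prop))
        (fun z hz => by
          rw [lap_comp_smul_sub hG, hl, mul_zero] <;> simp [hz.1, hz.2])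
        (fun z hz => by
          apply hp <;> simp [hz.1, hz.2])
        (x - p) (by simpa [← dist_eq_norm] using ⟨hx1, hx2⟩)
        (y - p) (by simpa [← dist_eq_norm] using ⟨hy1, hy2⟩)
      simp only [sub_neg_eq_add, sub_add_cancel, one_smul] at h1
      rw [← mul_pow]
      exact pow_le_pow_left₀ (hp x (by linarith) (by linarith)) h1 2
    rcases hsign with hp | hp
    · exact key H hH hlap hp
    · have h2 := key (fun x => 0 - H x) (contDiff_const.sub hH)
        (fun x h1 h2 => by rw [lap_sub contDiffAt_const hH.contDiffAt, lap_const, hlap x h1 h2,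
          sub_zero]) (fun x h1 h2 => by linarith [hp x h1 h2])
      simpa using h2
  have hB : ∀ y ∈ B, 3 ≤ dist y p ∧ dist y p ≤ 24 / 5 := by
    intro y hy
    have h1 : dist (p + EuclideanSpace.single j (9 / 2)) p = 9 / 2 := by simp
    have h2 := mem_closedBall.1 hy
    constructor
    · linarith [dist_triangle_left (p + EuclideanSpace.single j (9 / 2)) p y]
    · linarith [dist_triangle y (p + EuclideanSpace.single j (9 / 2)) p]
  have hcont : Continuous fun x => H x ^ 2 := hH.continuous.pow 2
  have hVE : volume.real E ≤ V := by
    have h1 : volume.real E ≤ volume.real (closedBall p 4) :=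
      measureReal_mono (fun x hx => hx.2) measure_closedBall_lt_top.ne
    rwa [Measure.real, Measure.real, Measure.addHaar_closedBall_center] at h1
  have hWB : volume.real B = W := by
    rw [hW, Measure.real, Measure.real, Measure.addHaar_closedBall_center]
  have h1 : ∀ y ∈ B, ∫ x in E, H x ^ 2 ≤ V * C ^ 2 * H y ^ 2 := by
    intro y hy
    calc ∫ x in E, H x ^ 2 ≤ ∫ x in E, C ^ 2 * H y ^ 2 := by
          refine setIntegral_mono_on (hcont.continuousOn.integrableOn_compact hEc)
            (integrableOn_const hEc.measure_lt_top.ne) hEc.measurableSet fun x hx => ?_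
          exact habs x hx.1 (by linarith [hx.2]) y (hB y hy).1 (hB y hy).2
      _ = volume.real E * (C ^ 2 * H y ^ 2) := by simp
      _ ≤ V * (C ^ 2 * H y ^ 2) := by gcongr
      _ = _ := by ring
  have hBc : IsCompact B := isCompact_closedBall _ _
  have h2 : ∫ y in B, (∫ x in E, H x ^ 2) ≤ ∫ y in B, V * C ^ 2 * H y ^ 2 :=
    setIntegral_mono_on (integrableOn_const hBc.measure_lt_top.ne)
      ((continuous_const.mul hcont).continuousOn.integrableOn_compact hBc) hBc.measurableSet h1
  rw [integral_const_mul] at h2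
  simp only [integral_const, smul_eq_mul, measureReal_restrict_apply_univ, hWB] at h2
  rw [div_mul_eq_mul_div, le_div_iff₀ hW0]
  linarith

end Energy

section Estimate

variable {n : ℕ} {H : EuclideanSpace ℝ (Fin n) → ℝ} {T : Finset (EuclideanSpace ℝ (Fin n))} {R : ℝ}

/-- The part of the annulus `11R/20 ≤ |x| ≤ 9R/10` at distance at least `31/10` from `T`. -/
def perforatedShell (T : Finset (EuclideanSpace ℝ (Fin n))) (R : ℝ) :
    Set (EuclideanSpace ℝ (Fin n)) :=
  {x | 11 / 20 * R ≤ ‖x‖ ∧ ‖x‖ ≤ 9 / 10 * R ∧ ∀ p ∈ T, 31 / 10 ≤ dist x p}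

lemma isCompact_annulus_diff (T : Finset (EuclideanSpace ℝ (Fin n))) (a b c : ℝ) :
    IsCompact {x | a ≤ ‖x‖ ∧ ‖x‖ ≤ b ∧ ∀ p ∈ T, c ≤ dist x p} := by
  have h1 := isCompact_shell (0 : EuclideanSpace ℝ (Fin n)) a b
  have h2 : IsClosed {x : EuclideanSpace ℝ (Fin n) | ∀ p ∈ T, c ≤ dist x p} := by
    simp only [Set.ofPred_forall]
    exact isClosed_biInter fun p _ => isClosed_le continuous_const (by fun_prop)
  convert h1.inter_right h2 using 1
  ext x
  simp [and_assoc]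

lemma isCompact_perforatedShell (T : Finset (EuclideanSpace ℝ (Fin n))) (R : ℝ) :
    IsCompact (perforatedShell T R) :=
  isCompact_annulus_diff T _ _ _

/-- The density `|∇H|² + H²`. -/
def energy (H : EuclideanSpace ℝ (Fin n) → ℝ) (x : EuclideanSpace ℝ (Fin n)) : ℝ :=
  ∑ i, pd i H x ^ 2 + H x ^ 2

lemma energy_nonneg (x : EuclideanSpace ℝ (Fin n)) : 0 ≤ energy H x :=
  add_nonneg (Finset.sum_nonneg fun _ _ => sq_nonneg _) (sq_nonneg _)

lemma continuous_sum_sq_pd (hH : ContDiff ℝ 2 H) : Continuous fun x => ∑ i, pd i H x ^ 2 :=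
  continuous_finsetSum _ fun _ _ => (contDiff_pd hH).continuous.pow 2

lemma continuous_energy (hH : ContDiff ℝ 2 H) : Continuous (energy H) :=
  (continuous_sum_sq_pd hH).add (hH.continuous.pow 2)

lemma integral_energy_le {A E : Set (EuclideanSpace ℝ (Fin n))} (hH : ContDiff ℝ 2 H)
    (hA : IsCompact A) (hE : IsCompact E) (hAE : A ⊆ E) {K : ℝ}
    (h : ∫ x in A, ∑ i, pd i H x ^ 2 ≤ K / 2 * ∫ x in E, H x ^ 2) :
    ∫ x in A, energy H x ≤ (K / 2 + 1) * ∫ x in E, H x ^ 2 := by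
  have h1 : Continuous fun x => H x ^ 2 := hH.continuous.pow 2
  have h2 : ∫ x in A, H x ^ 2 ≤ ∫ x in E, H x ^ 2 :=
    setIntegral_mono_set (h1.continuousOn.integrableOn_compact hE)
      (.of_forall fun x => sq_nonneg _) hAE.eventuallyLE
  unfold energy
  rw [integral_add ((continuous_sum_sq_pd hH).continuousOn.integrableOn_compact hA)
    (h1.continuousOn.integrableOn_compact hA)]
  linarith

lemma exists_integral_energy_annulus_le (n : ℕ) :
    ∃ K : ℝ, 0 ≤ K ∧ ∀ (T : Finset (EuclideanSpace ℝ (Fin n))) (R : ℝ)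
      (H : EuclideanSpace ℝ (Fin n) → ℝ), (∀ p ∈ T, ∀ q ∈ T, p ≠ q → 100 ≤ dist p q) → 100 < R →
      ContDiff ℝ 2 H →
      (∀ x, ‖x‖ < 19 / 20 * R → (∀ p ∈ T, 2 < dist x p) → lap H x = 0) →
      ∫ x in {x | 3 / 5 * R ≤ ‖x‖ ∧ ‖x‖ ≤ 4 / 5 * R ∧ ∀ p ∈ T, 33 / 10 ≤ dist x p}, energy H x ≤
        K * ∫ x in perforatedShell T R, H x ^ 2 := by
  obtain ⟨K₁, h₁⟩ := exists_isCutoff_ball n (a := 4 / 5) (b := 9 / 10) (by norm_num) (by norm_num)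
  obtain ⟨K₂, h₂⟩ := exists_isCutoff_ball n (a := 11 / 20) (b := 3 / 5) (by norm_num) (by norm_num)
  obtain ⟨K₃, h₃⟩ := exists_isCutoff_holes n (a := 31 / 10) (b := 33 / 10) (by norm_num)
    (by norm_num) (by norm_num)
  let K₁₂ := K₁ + K₂ + 2 * (n * (K₁ * K₂))
  let K := K₁₂ + K₃ + 2 * (n * (K₁₂ * K₃))
  refine ⟨max (K / 2 + 1) 0, le_max_right _ _, fun T R H hT hR hH hlap => ?_⟩
  obtain ⟨f₁, hf₁, hf₁', hf₁''⟩ := h₁ R 0 (by linarith)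
  obtain ⟨f₂, hf₂, hf₂', hf₂''⟩ := h₂ R 0 (by linarith)
  obtain ⟨f₃, hf₃, hf₃', hf₃''⟩ := h₃ T hT
  have hK : IsCutoff K _ := (hf₁.mul hf₂.one_sub).mul hf₃
  simp only [dist_zero_right] at *
  refine (integral_energy_le hH (isCompact_annulus_diff T _ _ _) (isCompact_perforatedShell T R)
    (fun x hx => ?_) (caccioppoli_le hH hK (isCompact_perforatedShell T R) (fun x hx => ?_)
      (fun x hx => ?_) (isCompact_annulus_diff T _ _ _).measurableSet fun x hx => ?_)).trans ?_
  · exact ⟨by linarith [hx.1], by linarith [hx.2.1], fun p hp => by linarith [hx.2.2 p hp]⟩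
  · by_cases h1 : 11 / 20 * R ≤ ‖x‖
    · by_cases h2 : ‖x‖ ≤ 9 / 10 * R
      · have h3 : ¬ ∀ p ∈ T, 31 / 10 ≤ dist x p := fun h3 => hx ⟨h1, h2, h3⟩
        push Not at h3
        obtain ⟨p, hp, h3⟩ := h3
        rw [hf₃' x p hp h3.le, mul_zero]
      · rw [hf₁'' x (not_le.1 h2).le]
        ring
    · rw [hf₂' x (not_le.1 h1).le]
      ring
  · exact hlap x (by linarith [hx.2.1]) fun p hp => by linarith [hx.2.2 p hp]
  · rw [hf₁' x hx.2.1, hf₂'' x hx.1, hf₃'' x hx.2.2]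
    ring
  · exact mul_le_mul_of_nonneg_right (le_max_left _ _) (integral_nonneg fun x => sq_nonneg _)

lemma exists_integral_energy_hole_le (hn : 2 ≤ n) (j : Fin n) :
    ∃ K : ℝ, 0 ≤ K ∧ ∀ (p : EuclideanSpace ℝ (Fin n)) (H : EuclideanSpace ℝ (Fin n) → ℝ),
      ContDiff ℝ 2 H → (∀ x, 2 < dist x p → dist x p < 5 → lap H x = 0) →
      ((∀ x, 2 < dist x p → dist x p < 5 → 0 ≤ H x) ∨
        (∀ x, 2 < dist x p → dist x p < 5 → H x ≤ 0)) →
      ∫ x in {x | 33 / 10 ≤ dist x p ∧ dist x p ≤ 37 / 10}, energy H x ≤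
        K * ∫ x in closedBall (p + EuclideanSpace.single j (9 / 2)) (3 / 10), H x ^ 2 := by
  obtain ⟨C, hC, hh⟩ := exists_shell_harnack hn j
  obtain ⟨K₁, h₁⟩ := exists_isCutoff_ball n (a := 37 / 10) (b := 38 / 10) (by norm_num)
    (by norm_num)
  obtain ⟨K₂, h₂⟩ := exists_isCutoff_ball n (a := 32 / 10) (b := 33 / 10) (by norm_num)
    (by norm_num)
  let K := K₁ + K₂ + 2 * (n * (K₁ * K₂))
  refine ⟨max (K / 2 + 1) 0 * C, by positivity, fun p H hH hlap hsign => ?_⟩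
  obtain ⟨f₁, hf₁, hf₁', hf₁''⟩ := h₁ 1 p le_rfl
  obtain ⟨f₂, hf₂, hf₂', hf₂''⟩ := h₂ 1 p le_rfl
  have hK : IsCutoff K _ := hf₁.mul hf₂.one_sub
  simp only [mul_one] at *
  have hE := isCompact_shell p 3 4
  refine (integral_energy_le hH (isCompact_shell p _ _) hE (fun x hx => ?_)
    (caccioppoli_le hH hK hE (fun x hx => ?_) (fun x hx => ?_)
      (isCompact_shell p _ _).measurableSet fun x hx => ?_)).trans ?_
  · exact ⟨by linarith [hx.1], by linarith [hx.2]⟩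
  · by_cases h1 : 3 ≤ dist x p
    · have h2 : ¬ dist x p ≤ 4 := fun h2 => hx ⟨h1, h2⟩
      rw [hf₁'' x (by linarith), zero_mul]
    · rw [hf₂' x (by linarith), sub_self, mul_zero]
  · exact hlap x (by linarith [hx.1]) (by linarith [hx.2])
  · rw [hf₁' x hx.2, hf₂'' x hx.1]
    ring
  · rw [mul_assoc]
    exact mul_le_mul (le_max_left _ _) (hh p H hH hlap hsign) (integral_nonneg fun x => sq_nonneg _)
      (le_max_right _ _)

lemma sum_setIntegral_closedBall_le (hT : ∀ p ∈ T, ∀ q ∈ T, p ≠ q → 100 ≤ dist p q)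
    (v : EuclideanSpace ℝ (Fin n)) {F : EuclideanSpace ℝ (Fin n) → ℝ} (hF : Integrable F)
    (hF0 : ∀ x, 0 ≤ F x) :
    ∑ p ∈ T, ∫ x in closedBall (p + v) (3 / 10), F x ≤ ∫ x, F x := by
  rw [← integral_biUnion_finset T (fun p _ => measurableSet_closedBall) ?_
    fun p _ => hF.integrableOn]
  · exact setIntegral_le_integral hF (.of_forall hF0)
  · intro p hp q hq hpq
    refine closedBall_disjoint_closedBall ?_
    rw [dist_add_right]
    linarith [hT p hp q hq hpq]

end Estimate

section Main

variable {n : ℕ} {H ξ : EuclideanSpace ℝ (Fin n) → ℝ} {T : Finset (EuclideanSpace ℝ (Fin n))}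
  {R K : ℝ}

lemma abs_coord_le (x : EuclideanSpace ℝ (Fin n)) (j : Fin n) : |x j| ≤ ‖x‖ := by
  simpa using PiLp.norm_apply_le x j

lemma lap_mul_sq_le_sum_indicator (hH : ContDiff ℝ 2 H) (hR : 100 < R)
    (hlap : ∀ x, ‖x‖ < 19 / 20 * R → (∀ p ∈ T, 2 < dist x p) → lap H x = 0)
    (hξ : IsCutoff K ξ)
    (hξ1 : ∀ x, ‖x‖ ≤ 7 / 10 * R → (∀ p ∈ T, 37 / 10 ≤ dist x p) → ξ x = 1)
    (hξ0 : ∀ x, 4 / 5 * R ≤ ‖x‖ → ξ x = 0) (hξ0' : ∀ x, ∀ p ∈ T, dist x p ≤ 33 / 10 → ξ x = 0)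
    (x : EuclideanSpace ℝ (Fin n)) :
    lap (fun y => ξ y * H y) x ^ 2 ≤ (8 * (n * K ^ 2) + 2 * K ^ 2) *
      ({x | 3 / 5 * R ≤ ‖x‖ ∧ ‖x‖ ≤ 4 / 5 * R ∧ ∀ p ∈ T, 33 / 10 ≤ dist x p}.indicator
          (energy H) x +
        ∑ p ∈ T with ‖p‖ ≤ 13 / 20 * R,
          {x | 33 / 10 ≤ dist x p ∧ dist x p ≤ 37 / 10}.indicator (energy H) x) := by
  have hM : 0 ≤ 8 * (n * K ^ 2) + 2 * K ^ 2 := by positivity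
  have hs (p : EuclideanSpace ℝ (Fin n)) :
      0 ≤ {x | 33 / 10 ≤ dist x p ∧ dist x p ≤ 37 / 10}.indicator (energy H) x :=
    indicator_nonneg (fun x _ => energy_nonneg x) x
  have hs' : 0 ≤ {x | 3 / 5 * R ≤ ‖x‖ ∧ ‖x‖ ≤ 4 / 5 * R ∧ ∀ p ∈ T, 33 / 10 ≤ dist x p}.indicator
      (energy H) x := indicator_nonneg (fun x _ => energy_nonneg x) x
  have hsum : 0 ≤ ∑ p ∈ T with ‖p‖ ≤ 13 / 20 * R,
      {x | 33 / 10 ≤ dist x p ∧ dist x p ≤ 37 / 10}.indicator (energy H) x :=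
    Finset.sum_nonneg fun p _ => hs p
  have zero (h : lap (fun y => ξ y * H y) x = 0) : lap (fun y => ξ y * H y) x ^ 2 ≤
      (8 * (n * K ^ 2) + 2 * K ^ 2) *
      ({x | 3 / 5 * R ≤ ‖x‖ ∧ ‖x‖ ≤ 4 / 5 * R ∧ ∀ p ∈ T, 33 / 10 ≤ dist x p}.indicator
          (energy H) x +
        ∑ p ∈ T with ‖p‖ ≤ 13 / 20 * R,
          {x | 33 / 10 ≤ dist x p ∧ dist x p ≤ 37 / 10}.indicator (energy H) x) := by
    rw [h, zero_pow two_ne_zero]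
    exact mul_nonneg hM (add_nonneg hs' hsum)
  have vanish (h : ∀ᶠ y in 𝓝 x, ξ y = 0) : lap (fun y => ξ y * H y) x = 0 := by
    rw [lap_congr (g := fun _ => 0) (by filter_upwards [h] with y hy; rw [hy, zero_mul]), lap_const]
  by_cases h1 : ‖x‖ ≤ 4 / 5 * R
  swap
  · refine zero (vanish ?_)
    filter_upwards [(continuous_norm.tendsto x).eventually_const_lt (not_le.1 h1)] with y hy
    exact hξ0 y hy.le
  by_cases h2 : ∀ p ∈ T, 33 / 10 ≤ dist x p
  swap
  · push Not at h2
    obtain ⟨p, hp, h2⟩ := h2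
    refine zero (vanish ?_)
    filter_upwards [isOpen_ball.mem_nhds (mem_ball.2 h2)] with y hy
    exact hξ0' y p hp (mem_ball.1 hy).le
  have hl : lap H x = 0 := hlap x (by linarith) fun p hp => by linarith [h2 p hp]
  have hle := lap_mul_sq_le hH hξ (x := x) (by rw [hl, mul_zero])
  by_cases h3 : 3 / 5 * R ≤ ‖x‖
  · refine hle.trans (mul_le_mul_of_nonneg_left ?_ hM)
    rw [indicator_of_mem]
    · exact le_add_of_nonneg_right hsum
    · exact ⟨h3, h1, h2⟩
  by_cases h4 : ∃ p ∈ T, dist x p ≤ 37 / 10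
  · obtain ⟨p, hp, h4⟩ := h4
    refine hle.trans (mul_le_mul_of_nonneg_left ?_ hM)
    have hpR : ‖p‖ ≤ 13 / 20 * R := by
      have := norm_le_norm_add_norm_sub' p x
      rw [← dist_eq_norm, dist_comm] at this
      linarith
    refine le_trans (le_of_eq ?_) ((Finset.single_le_sum (fun p _ => hs p)
      (Finset.mem_filter.2 ⟨hp, hpR⟩)).trans (le_add_of_nonneg_left hs'))
    rw [indicator_of_mem]
    · rfl
    · exact ⟨h2 p hp, h4⟩
  · push Not at h4
    refine zero ?_
    rw [lap_congr (g := H), hl]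
    have h5 : ∀ᶠ y in 𝓝 x, ∀ p ∈ T, 37 / 10 < dist y p :=
      (Filter.eventually_all_finset T).2 fun p hp =>
        ((show Continuous fun y => dist y p by fun_prop).tendsto x).eventually_const_lt (h4 p hp)
    filter_upwards [h5, (continuous_norm.tendsto x).eventually_lt_const (not_le.1 h3)]
      with y hy hy'
    rw [hξ1 y (by linarith) fun p hp => (hy p hp).le, one_mul]

lemma integral_le_of_le_sum_indicator {F f₀ e : EuclideanSpace ℝ (Fin n) → ℝ}
    {A : EuclideanSpace ℝ (Fin n) → Set (EuclideanSpace ℝ (Fin n))}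
    {c : EuclideanSpace ℝ (Fin n) → ℝ} {M : ℝ} (hF : Integrable F) (hf₀ : Integrable f₀)
    (he : Continuous e) (hA : ∀ p, IsCompact (A p))
    (h : ∀ x, F x ≤ M * (f₀ x + ∑ p ∈ T, c p * (A p).indicator e x)) :
    ∫ x, F x ≤ M * ((∫ x, f₀ x) + ∑ p ∈ T, c p * ∫ x in A p, e x) := by
  have hi (p : EuclideanSpace ℝ (Fin n)) : Integrable fun x => c p * (A p).indicator e x :=
    ((he.continuousOn.integrableOn_compact (hA p)).integrable_indicator
      (hA p).measurableSet).const_mul _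
  have hs : Integrable fun x => ∑ p ∈ T, c p * (A p).indicator e x :=
    integrable_finsetSum _ fun p _ => hi p
  refine (integral_mono hF ((hf₀.add hs).const_mul M) h).trans (le_of_eq ?_)
  simp only [Pi.add_apply]
  rw [integral_const_mul, integral_add hf₀ hs, integral_finsetSum _ fun p _ => hi p]
  simp only [integral_const_mul, integral_indicator (hA _).measurableSet]

lemma indicator_mul_exp_le {e : EuclideanSpace ℝ (Fin n) → ℝ} (he : ∀ x, 0 ≤ e x)
    {A : Set (EuclideanSpace ℝ (Fin n))} {j : Fin n} {k b : ℝ} (hk : 0 ≤ k) (hb : ∀ x ∈ A, x j ≤ b)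
    (x : EuclideanSpace ℝ (Fin n)) :
    A.indicator e x * Real.exp (2 * k * x j) ≤ Real.exp (2 * k * b) * A.indicator e x := by
  by_cases hx : x ∈ A
  · rw [indicator_of_mem hx, mul_comm]
    have := hb x hx
    gcongr
    exact he x
  · simp [indicator_of_notMem hx]

lemma dist_lt_of_near (hT : ∀ p ∈ T, ∀ q ∈ T, p ≠ q → 100 ≤ dist p q)
    {p q x : EuclideanSpace ℝ (Fin n)} (hp : p ∈ T) (hq : q ∈ T) (hx : dist x p ≤ 5) :
    q = p ∨ 95 ≤ dist x q := by
  by_cases h : q = p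
  · exact .inl h
  · have := hT p hp q hq (Ne.symm h)
    exact .inr (by linarith [dist_triangle_left p q x])

lemma isOpen_ball_diff (T : Finset (EuclideanSpace ℝ (Fin n))) (a b : ℝ) :
    IsOpen {x | ‖x‖ < a ∧ ∀ p ∈ T, b < dist x p} := by
  have h1 : IsOpen {x : EuclideanSpace ℝ (Fin n) | ‖x‖ < a} :=
    isOpen_lt continuous_norm continuous_const
  have h2 : IsOpen {x : EuclideanSpace ℝ (Fin n) | ∀ p ∈ T, b < dist x p} := by
    simp only [Set.ofPred_forall]
    exact isOpen_biInter_finset fun p _ => isOpen_lt continuous_const (by fun_prop)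
  exact h1.inter h2

lemma integral_inner_le_add_sum {u : EuclideanSpace ℝ (Fin n) → ℝ} (hR : 100 < R)
    (hH : ContDiff ℝ 2 H) (hu : Integrable fun x => u x ^ 2)
    (huH : ∀ x, ‖x‖ ≤ 7 / 10 * R → (∀ p ∈ T, 37 / 10 ≤ dist x p) → u x = H x) :
    ∫ x in {x | ‖x‖ < R / 2 ∧ ∀ p ∈ T, 3 < dist x p}, H x ^ 2 ≤
      (∫ x, u x ^ 2) + ∑ p ∈ T with ‖p‖ ≤ 13 / 20 * R,
        ∫ x in {x | 3 ≤ dist x p ∧ dist x p ≤ 4}, H x ^ 2 := by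
  have hO := (isOpen_ball_diff T (R / 2) 3).measurableSet
  have h1 := integral_le_of_le_sum_indicator (T := {p ∈ T | ‖p‖ ≤ 13 / 20 * R}) (M := 1)
    (e := fun x => H x ^ 2)
    (F := {x | ‖x‖ < R / 2 ∧ ∀ p ∈ T, 3 < dist x p}.indicator fun x => H x ^ 2)
    (A := fun p => {x | 3 ≤ dist x p ∧ dist x p ≤ 4}) (c := fun _ => 1)
    (((hH.continuous.pow 2).continuousOn.integrableOn_compact
      (isCompact_closedBall 0 (R / 2))).mono_set (fun x hx => by simpa using hx.1.le)
      |>.integrable_indicator hO) hu (hH.continuous.pow 2)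
    (fun p => isCompact_shell p _ _) fun x => ?_
  · rw [integral_indicator hO] at h1
    simpa only [one_mul] using h1
  simp only [one_mul]
  have hs0 : ∀ p ∈ {p ∈ T | ‖p‖ ≤ 13 / 20 * R}, 0 ≤
      {x | 3 ≤ dist x p ∧ dist x p ≤ 4}.indicator (fun x => H x ^ 2) x := fun p _ =>
    indicator_nonneg (fun x _ => sq_nonneg _) x
  have hs1 := Finset.sum_nonneg hs0
  by_cases hx : x ∈ {x | ‖x‖ < R / 2 ∧ ∀ p ∈ T, 3 < dist x p}
  swap
  · rw [indicator_of_notMem hx]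
    exact add_nonneg (sq_nonneg _) hs1
  rw [indicator_of_mem hx]
  by_cases h4 : ∃ p ∈ T, dist x p ≤ 4
  · obtain ⟨p, hp, h4⟩ := h4
    have hpR : ‖p‖ ≤ 13 / 20 * R := by
      have := norm_le_norm_add_norm_sub' p x
      rw [← dist_eq_norm, dist_comm] at this
      linarith [hx.1]
    have h5 := Finset.single_le_sum hs0 (Finset.mem_filter.2 ⟨hp, hpR⟩)
    rw [indicator_of_mem] at h5
    · exact h5.trans (le_add_of_nonneg_left (sq_nonneg _))
    · exact ⟨(hx.2 p hp).le, h4⟩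
  · push Not at h4
    rw [huH x (by linarith [hx.1]) fun p hp => by linarith [h4 p hp]]
    exact le_add_of_nonneg_right hs1

set_option maxHeartbeats 400000 in
lemma exists_integral_inner_le (hn : 2 ≤ n) (j : Fin n) :
    ∃ M : ℝ, 0 ≤ M ∧ ∀ (T : Finset (EuclideanSpace ℝ (Fin n))) (R : ℝ)
      (H : EuclideanSpace ℝ (Fin n) → ℝ), (∀ p ∈ T, ∀ q ∈ T, p ≠ q → 100 ≤ dist p q) → 100 < R →
      ContDiff ℝ 2 H →
      (∀ x, ‖x‖ < 19 / 20 * R → (∀ p ∈ T, 2 < dist x p) → lap H x = 0) →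
      (∀ p ∈ T, ‖p‖ ≤ 13 / 20 * R → (∀ x, 2 < dist x p → dist x p < 5 → 0 ≤ H x) ∨
        (∀ x, 2 < dist x p → dist x p < 5 → H x ≤ 0)) →
      ∀ k : ℝ, 1 ≤ k → R ^ 2 * M * Real.exp (-k) ≤ 1 / 2 →
      ∫ x in {x | ‖x‖ < R / 2 ∧ ∀ p ∈ T, 3 < dist x p}, H x ^ 2 ≤
        (1 + M) * (2 * R ^ 2 * M * Real.exp (4 * k * R)) *
          ∫ x in perforatedShell T R, H x ^ 2 := by
  obtain ⟨Ka, hKa, ha⟩ := exists_integral_energy_annulus_le n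
  obtain ⟨Kh, hKh, hh⟩ := exists_integral_energy_hole_le hn j
  obtain ⟨Ks, hKs, hs⟩ := exists_shell_harnack hn j
  obtain ⟨L₁, hL₁⟩ := exists_isCutoff_ball n (a := 7 / 10) (b := 8 / 10) (by norm_num) (by norm_num)
  obtain ⟨L₂, hL₂⟩ := exists_isCutoff_holes n (a := 33 / 10) (b := 37 / 10) (by norm_num)
    (by norm_num) (by norm_num)
  let L := L₁ + L₂ + 2 * (n * (L₁ * L₂))
  let M₁ := 8 * (n * L ^ 2) + 2 * L ^ 2
  have hM₁ : 0 ≤ M₁ := by positivity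
  let M := M₁ * Ka + M₁ * Kh + Ks
  refine ⟨M, by positivity, fun T R H hT hR hH hlap hsign k hk hkM => ?_⟩
  obtain ⟨f₁, hf₁, hf₁', hf₁''⟩ := hL₁ R 0 (by linarith)
  obtain ⟨f₂, hf₂, hf₂', hf₂''⟩ := hL₂ T hT
  simp only [dist_zero_right] at hf₁' hf₁''
  have hξ : IsCutoff L fun x => f₁ x * f₂ x := hf₁.mul hf₂
  set ξ := fun x => f₁ x * f₂ x
  have hξ1 (x) (h1 : ‖x‖ ≤ 7 / 10 * R) (h2 : ∀ p ∈ T, 37 / 10 ≤ dist x p) : ξ x = 1 := by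
    simp only [ξ]
    rw [hf₁' x h1, hf₂'' x h2, one_mul]
  have hξ0 (x) (h : 4 / 5 * R ≤ ‖x‖) : ξ x = 0 := by
    simp only [ξ]
    rw [hf₁'' x (by linarith), zero_mul]
  have hξ0' (x) (p) (hp : p ∈ T) (h : dist x p ≤ 33 / 10) : ξ x = 0 := by
    simp only [ξ]
    rw [hf₂' x p hp h, mul_zero]
  set u := fun x => ξ x * H x with hu
  have huC : ContDiff ℝ 2 u := hξ.contDiff.mul hH
  have hne (x) (h : u x ≠ 0) : ‖x‖ < 4 / 5 * R := by
    by_contra h'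
    exact h (by simp only [hu]; rw [hξ0 x (not_lt.1 h'), zero_mul])
  have huc : HasCompactSupport u := HasCompactSupport.intro (isCompact_closedBall 0 (4 / 5 * R))
    fun x hx => by
      by_contra h
      exact hx (mem_closedBall_zero_iff.2 (hne x h).le)
  have hcoord (x) (h : u x ≠ 0) : |x j| ≤ R := by linarith [abs_coord_le x j, hne x h]
  have hk0 : 0 < k := by linarith
  set w : EuclideanSpace ℝ (Fin n) → ℝ := fun x => Real.exp (2 * k * x j) with hw
  have hwc : Continuous w := by fun_prop
  set S := {p ∈ T | ‖p‖ ≤ 13 / 20 * R} with hS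
  have hST {p} (hp : p ∈ S) : p ∈ T := (Finset.mem_filter.1 hp).1
  have hSR {p} (hp : p ∈ S) : ‖p‖ ≤ 13 / 20 * R := (Finset.mem_filter.1 hp).2
  have hnorm {x p : EuclideanSpace ℝ (Fin n)} : ‖x‖ ≤ ‖p‖ + dist x p := by
    rw [dist_eq_norm]
    exact norm_le_norm_add_norm_sub' x p
  have hlapS {p} (hp : p ∈ S) (x) (h2 : 2 < dist x p) (h5 : dist x p < 5) : lap H x = 0 := by
    refine hlap x (by linarith [hSR hp, hnorm (x := x) (p := p)]) fun q hq => ?_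
    rcases dist_lt_of_near hT (hST hp) hq h5.le with rfl | h
    · exact h2
    · linarith
  set J := ∫ x, u x ^ 2 * w x with hJ
  set I := ∫ x in perforatedShell T R, H x ^ 2
  have hI : 0 ≤ I := integral_nonneg fun x => sq_nonneg _
  let B (p : EuclideanSpace ℝ (Fin n)) := closedBall (p + EuclideanSpace.single j (9 / 2)) (3 / 10)
  have hBu {p} (hp : p ∈ S) {x} (hx : x ∈ B p) : u x = H x := by
    have h1 : dist (p + EuclideanSpace.single j (9 / 2)) p = 9 / 2 := by simp
    have h2 := mem_closedBall.1 hx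
    have h3 := dist_triangle x (p + EuclideanSpace.single j (9 / 2)) p
    have h4 := dist_triangle_left (p + EuclideanSpace.single j (9 / 2)) p x
    simp only [hu]
    rw [hξ1 x (by linarith [hSR hp, hnorm (x := x) (p := p)]), one_mul]
    intro q hq
    rcases dist_lt_of_near hT (hST hp) hq (x := x) (by linarith) with rfl | h <;> linarith
  have hBj {p x : EuclideanSpace ℝ (Fin n)} (hx : x ∈ B p) : p j + 42 / 10 ≤ x j := by
    have h2 := mem_closedBall.1 hx
    rw [dist_eq_norm] at h2
    have h3 := (abs_le.1 ((abs_coord_le _ j).trans h2)).1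
    simp at h3
    linarith
  have hu2 : Continuous fun x => u x ^ 2 := huC.continuous.pow 2
  have hu2i : Integrable fun x => u x ^ 2 :=
    hu2.integrable_of_hasCompactSupport (hasCompactSupport_sq huc)
  have huw : Integrable fun x => u x ^ 2 * w x :=
    (hu2.mul hwc).integrable_of_hasCompactSupport (hasCompactSupport_sq huc).mul_right
  have hsumJ : ∑ p ∈ S, ∫ x in B p, u x ^ 2 * w x ≤ J :=
    sum_setIntegral_closedBall_le (fun p hp q hq => hT p (hST hp) q (hST hq)) _ huw
      fun x => mul_nonneg (sq_nonneg _) (Real.exp_pos _).le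
  have hsumu : ∑ p ∈ S, ∫ x in B p, H x ^ 2 ≤ ∫ x, u x ^ 2 := by
    refine le_trans (le_of_eq ?_) (sum_setIntegral_closedBall_le (T := S)
      (fun p hp q hq => hT p (hST hp) q (hST hq)) (EuclideanSpace.single j (9 / 2)) hu2i
      fun x => sq_nonneg _)
    exact Finset.sum_congr rfl fun p hp =>
      setIntegral_congr_fun measurableSet_closedBall fun x hx => by rw [hBu hp hx]
  have hhole {p} (hp : p ∈ S) : Real.exp (2 * k * (p j + 37 / 10)) *
      ∫ x in {x | 33 / 10 ≤ dist x p ∧ dist x p ≤ 37 / 10}, energy H x ≤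
        Kh * (Real.exp (-k) * ∫ x in B p, u x ^ 2 * w x) := by
    have h1 := hh p H hH (hlapS hp) (hsign p (hST hp) (hSR hp))
    have h2 : Real.exp (2 * k * (p j + 37 / 10)) * ∫ x in B p, H x ^ 2 ≤
        Real.exp (-k) * ∫ x in B p, u x ^ 2 * w x := by
      rw [← integral_const_mul, ← integral_const_mul]
      refine setIntegral_mono_on ?_ (huw.integrableOn.const_mul _) measurableSet_closedBall
        fun x hx => ?_
      · exact (continuous_const.mul (hH.continuous.pow 2)).continuousOn.integrableOn_compact
          (isCompact_closedBall _ _)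
      · rw [hBu hp hx, mul_left_comm, mul_comm _ (H x ^ 2), ← Real.exp_add]
        refine mul_le_mul_of_nonneg_left (Real.exp_le_exp.2 ?_) (sq_nonneg _)
        nlinarith [hBj hx]
    calc _ ≤ Real.exp (2 * k * (p j + 37 / 10)) * (Kh * ∫ x in B p, H x ^ 2) := by gcongr
      _ = Kh * (Real.exp (2 * k * (p j + 37 / 10)) * ∫ x in B p, H x ^ 2) := by ring
      _ ≤ _ := by gcongr
  have hA := isCompact_annulus_diff T (3 / 5 * R) (4 / 5 * R) (33 / 10)
  have hlapu : ∫ x, lap u x ^ 2 * w x ≤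
      M * (Real.exp (2 * k * R) * I) + M * (Real.exp (-k) * J) := by
    have hli : Integrable fun x => lap u x ^ 2 * w x :=
      (((continuous_lap huC).pow 2).mul hwc).integrable_of_hasCompactSupport
        (hasCompactSupport_sq (hasCompactSupport_lap huc)).mul_right
    have h1 := integral_le_of_le_sum_indicator (T := S) (M := M₁) (e := energy H)
      (A := fun p => {x | 33 / 10 ≤ dist x p ∧ dist x p ≤ 37 / 10})
      (c := fun p => Real.exp (2 * k * (p j + 37 / 10))) hli
      (((((continuous_energy hH).continuousOn.integrableOn_compact hA).integrable_indicator
        hA.measurableSet)).const_mul (Real.exp (2 * k * R))) (continuous_energy hH)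
      (fun p => isCompact_shell p _ _) fun x => by
        refine (mul_le_mul_of_nonneg_right (lap_mul_sq_le_sum_indicator hH hR hlap hξ hξ1 hξ0
          hξ0' x) (Real.exp_pos _).le).trans ?_
        rw [mul_assoc]
        refine mul_le_mul_of_nonneg_left ?_ hM₁
        rw [add_mul, Finset.sum_mul]
        refine add_le_add ?_ (Finset.sum_le_sum fun p _ => ?_)
        · refine indicator_mul_exp_le energy_nonneg hk0.le (fun x hx => ?_) x
          linarith [(abs_le.1 (abs_coord_le x j)).2, hx.2.1]
        · refine indicator_mul_exp_le energy_nonneg hk0.le (fun x hx => ?_) x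
          have h3 := (abs_le.1 ((abs_coord_le (x - p) j).trans (dist_eq_norm x p ▸ hx.2))).2
          simp at h3
          linarith
    rw [integral_const_mul, integral_indicator hA.measurableSet] at h1
    have h2 := ha T R H hT hR hH hlap
    have h3 : ∑ p ∈ S, Real.exp (2 * k * (p j + 37 / 10)) *
        ∫ x in {x | 33 / 10 ≤ dist x p ∧ dist x p ≤ 37 / 10}, energy H x ≤
          Kh * (Real.exp (-k) * J) := by
      refine (Finset.sum_le_sum fun p hp => hhole hp).trans ?_
      rw [← Finset.mul_sum, ← Finset.mul_sum]
      gcongr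
    have hJ0 : 0 ≤ J := integral_nonneg fun x => mul_nonneg (sq_nonneg _) (Real.exp_pos _).le
    calc _ ≤ _ := h1
      _ ≤ M₁ * (Real.exp (2 * k * R) * (Ka * I) + Kh * (Real.exp (-k) * J)) := by gcongr
      _ = M₁ * Ka * (Real.exp (2 * k * R) * I) + M₁ * Kh * (Real.exp (-k) * J) := by ring
      _ ≤ _ := by
        have h4 : 0 ≤ M₁ * Ka := by positivity
        have h5 : 0 ≤ M₁ * Kh := by positivity
        gcongr <;> simp only [M] <;> linarith
  have hJ0 : 0 ≤ J := integral_nonneg fun x => mul_nonneg (sq_nonneg _) (Real.exp_pos _).le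
  have hM : 0 ≤ M := by positivity
  have hJle : J ≤ 2 * R ^ 2 * M * Real.exp (2 * k * R) * I := by
    have h1 := carleman huC huc hk0 hcoord
    have h2 : R ^ 2 / k ^ 2 ≤ R ^ 2 := div_le_self (sq_nonneg _) (one_le_pow₀ hk)
    have h3 : J ≤ R ^ 2 * (M * (Real.exp (2 * k * R) * I) + M * (Real.exp (-k) * J)) :=
      h1.trans (mul_le_mul h2 hlapu (integral_nonneg fun x =>
        mul_nonneg (sq_nonneg _) (Real.exp_pos _).le) (sq_nonneg _))
    have h4 := mul_le_mul_of_nonneg_right hkM hJ0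
    linarith
  have huJ : ∫ x, u x ^ 2 ≤ Real.exp (2 * k * R) * J := by
    rw [hJ, ← integral_const_mul]
    refine integral_mono hu2i (huw.const_mul _) fun x => ?_
    by_cases hx : u x = 0
    · simp [hx]
    · change u x ^ 2 ≤ Real.exp (2 * k * R) * (u x ^ 2 * Real.exp (2 * k * x j))
      rw [mul_left_comm, ← Real.exp_add]
      refine le_mul_of_one_le_right (sq_nonneg _) (Real.one_le_exp ?_)
      nlinarith [(abs_le.1 (hcoord x hx)).1]
  have hinner : ∫ x in {x | ‖x‖ < R / 2 ∧ ∀ p ∈ T, 3 < dist x p}, H x ^ 2 ≤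
      (1 + M) * ∫ x, u x ^ 2 := by
    have h1 := integral_inner_le_add_sum hR hH hu2i fun x hx h => by
      simp only [hu]
      rw [hξ1 x hx h, one_mul]
    have h2 : ∑ p ∈ S, ∫ x in {x | 3 ≤ dist x p ∧ dist x p ≤ 4}, H x ^ 2 ≤
        Ks * ∫ x, u x ^ 2 := by
      refine (Finset.sum_le_sum fun p hp => ?_).trans
        ((Finset.mul_sum S (fun p => ∫ x in B p, H x ^ 2) Ks).symm.le.trans
          (mul_le_mul_of_nonneg_left hsumu hKs))
      exact hs p H hH (hlapS hp) (hsign p (hST hp) (hSR hp))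
    have h3 : Ks ≤ M := by
      have h4 : 0 ≤ M₁ * Ka := by positivity
      have h5 : 0 ≤ M₁ * Kh := by positivity
      simp only [M]
      linarith
    have h4 : 0 ≤ ∫ x, u x ^ 2 := integral_nonneg fun x => sq_nonneg _
    linarith [mul_le_mul_of_nonneg_right h3 h4]
  calc _ ≤ _ := hinner
    _ ≤ (1 + M) * (Real.exp (2 * k * R) * (2 * R ^ 2 * M * Real.exp (2 * k * R) * I)) := by
        gcongr
        exact huJ.trans (by gcongr)
    _ = _ := by
        rw [show 4 * k * R = 2 * k * R + 2 * k * R by ring, Real.exp_add]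
        ring

lemma exists_integral_inner_le_exp (hn : 2 ≤ n) :
    ∃ C : ℝ, 0 < C ∧ ∀ (T : Finset (EuclideanSpace ℝ (Fin n))) (R : ℝ)
      (H : EuclideanSpace ℝ (Fin n) → ℝ), (∀ p ∈ T, ∀ q ∈ T, p ≠ q → 100 ≤ dist p q) → 100 < R →
      ContDiff ℝ 2 H →
      (∀ x, ‖x‖ < 19 / 20 * R → (∀ p ∈ T, 2 < dist x p) → lap H x = 0) →
      (∀ p ∈ T, ‖p‖ ≤ 13 / 20 * R → (∀ x, 2 < dist x p → dist x p < 5 → 0 ≤ H x) ∨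
        (∀ x, 2 < dist x p → dist x p < 5 → H x ≤ 0)) →
      ∫ x in {x | ‖x‖ < R / 2 ∧ ∀ p ∈ T, 3 < dist x p}, H x ^ 2 ≤
        Real.exp (C * R * Real.log R) * ∫ x in perforatedShell T R, H x ^ 2 := by
  obtain ⟨M, hM, h⟩ := exists_integral_inner_le hn ⟨0, by omega⟩
  set a := Real.log (2 * M + 1) with ha
  have ha0 : 0 ≤ a := Real.log_nonneg (by linarith)
  set b := Real.log (1 + (1 + M) * (2 * M)) with hb
  have hb0 : 0 ≤ b := Real.log_nonneg (by nlinarith)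
  refine ⟨b + 2 + 4 * (2 + a), by positivity, fun T R H hT hR hH hlap hsign => ?_⟩
  have hR0 : 0 < R := by linarith
  have hlog : 1 ≤ Real.log R := by
    rw [Real.le_log_iff_exp_le hR0]
    linarith [Real.exp_one_lt_d9]
  have hR2 : R ^ 2 = Real.exp (2 * Real.log R) := by
    rw [← Real.exp_log hR0, Real.log_exp, ← Real.exp_nat_mul]
    norm_num
  refine (h T R H hT hR hH hlap hsign ((2 + a) * Real.log R) (by nlinarith) ?_).trans ?_
  · have h1 : Real.exp (-((2 + a) * Real.log R)) ≤
        Real.exp (-(2 * Real.log R)) * (2 * M + 1)⁻¹ := by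
      rw [← Real.exp_log (show (0 : ℝ) < 2 * M + 1 by positivity), ← Real.exp_neg, ← Real.exp_add]
      refine Real.exp_le_exp.2 ?_
      rw [← ha]
      nlinarith
    calc _ ≤ R ^ 2 * M * (Real.exp (-(2 * Real.log R)) * (2 * M + 1)⁻¹) := by gcongr
      _ = M * (2 * M + 1)⁻¹ := by
        rw [Real.exp_neg, ← hR2]
        field_simp
      _ ≤ 1 / 2 := by
        rw [← div_eq_mul_inv, div_le_div_iff₀ (by positivity) (by norm_num)]
        linarith
  · refine mul_le_mul_of_nonneg_right ?_ (integral_nonneg fun x => sq_nonneg _)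
    have h1 : (1 + M) * (2 * M) ≤ Real.exp b := by
      rw [hb, Real.exp_log (by positivity)]
      linarith
    have hRl : 1 ≤ R * Real.log R := by nlinarith
    calc _ = (1 + M) * (2 * M) * (R ^ 2 * Real.exp (4 * ((2 + a) * Real.log R) * R)) := by ring
      _ ≤ Real.exp b * (Real.exp (2 * Real.log R) *
          Real.exp (4 * ((2 + a) * Real.log R) * R)) := by
        rw [hR2]
        gcongr
      _ = Real.exp (b + 2 * Real.log R + 4 * ((2 + a) * Real.log R) * R) := by
        rw [Real.exp_add, Real.exp_add]
        ring
      _ ≤ _ := by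
        refine Real.exp_le_exp.2 ?_
        nlinarith [mul_le_mul_of_nonneg_left hRl hb0]

lemma finite_inter_closedBall_of_pairwise {s : Set (EuclideanSpace ℝ (Fin n))} {ε : ℝ}
    (hε : 0 < ε) (hs : s.Pairwise fun p q => ε ≤ dist p q) (r : ℝ) :
    (closedBall 0 r ∩ s).Finite := by
  refine Metric.finite_isBounded_inter_isClosed ⟨DiscreteTopology.of_forall_le_dist hε ?_⟩
    isBounded_closedBall (Metric.isClosed_of_pairwise_le_dist hε hs)
  exact fun p q hpq => hs p.2 q.2 fun h => hpq (Subtype.ext h)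

lemma exists_contDiff_eqOn {T : Finset (EuclideanSpace ℝ (Fin n))} {R : ℝ}
    {h : EuclideanSpace ℝ (Fin n) → ℝ} (hT : ∀ p ∈ T, ∀ q ∈ T, p ≠ q → 100 ≤ dist p q)
    (hR : 100 < R) (hh : ∀ x, ‖x‖ < R → (∀ p ∈ T, 1 < dist x p) → ContDiffAt ℝ 2 h x) :
    ∃ H, ContDiff ℝ 2 H ∧
      ∀ x, ‖x‖ ≤ 96 / 100 * R → (∀ p ∈ T, 2 ≤ dist x p) → H x = h x := by
  obtain ⟨K, hK⟩ := exists_isCutoff_ball n (a := 96 / 100) (b := 98 / 100) (by norm_num)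
    (by norm_num)
  obtain ⟨χ, hχ, hχ1, hχ0⟩ := hK R 0 (by linarith)
  obtain ⟨K', hK'⟩ := exists_isCutoff_holes n (a := 3 / 2) (b := 2) (by norm_num)
    (by norm_num) (by norm_num)
  obtain ⟨β, hβ, hβ0, hβ1⟩ := hK' T hT
  simp only [dist_zero_right] at hχ1 hχ0
  refine ⟨fun x => χ x * β x * h x, ?_, fun x hx hxT => by simp [hχ1 x hx, hβ1 x hxT]⟩
  refine contDiff_iff_contDiffAt.2 fun x => ?_
  by_cases h1 : ‖x‖ < R
  · by_cases h2 : ∀ p ∈ T, 1 < dist x p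
    · exact (hχ.contDiff.contDiffAt.mul hβ.contDiff.contDiffAt).mul (hh x h1 h2)
    · push Not at h2
      obtain ⟨p, hp, hxp⟩ := h2
      refine (contDiffAt_const (c := 0)).congr_of_eventuallyEq ?_
      filter_upwards [ball_mem_nhds x (show (0 : ℝ) < 1 / 2 by norm_num)] with y hy
      have h3 := mem_ball.1 hy
      rw [hβ0 y p hp (by linarith [dist_triangle y x p])]
      simp
  · refine (contDiffAt_const (c := 0)).congr_of_eventuallyEq ?_
    filter_upwards [ball_mem_nhds x (show (0 : ℝ) < 1 by norm_num)] with y hy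
    have h3 := mem_ball'.1 hy
    rw [dist_eq_norm] at h3
    rw [hχ0 y (by linarith [norm_sub_norm_le x y])]
    simp

end Main

/-- **Toy problem with an extra logarithm, in any dimension `n ≥ 2`.** -/
theorem toy_problem_higher_dim :
    ∀ n : ℕ, 2 ≤ n → ∃ C : ℝ, 0 < C ∧
      ∀ (ι : Type) (c : ι → EuclideanSpace ℝ (Fin n)) (R : ℝ)
        (h : EuclideanSpace ℝ (Fin n) → ℝ),
        UnitBallsSeparated c 100 → 100 < R →
        HarmonicOnSet h (ball (0 : EuclideanSpace ℝ (Fin n)) R \ ⋃ i, closedBall (c i) 1) →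
        (∀ i, NoSignChange h (ball (0 : EuclideanSpace ℝ (Fin n)) R ∩
          (closedBall (c i) 5 \ closedBall (c i) 1))) →
        ENNReal.ofReal (Real.exp (-(C * R * Real.log R))) *
            (∫⁻ x in ball (0 : EuclideanSpace ℝ (Fin n)) (R / 2) \ ⋃ i, closedBall (c i) 3,
              ENNReal.ofReal (h x ^ 2)) ≤
          ∫⁻ x in ball (0 : EuclideanSpace ℝ (Fin n)) R \
              (ball (0 : EuclideanSpace ℝ (Fin n)) (R / 2) ∪ ⋃ i, closedBall (c i) 3),
            ENNReal.ofReal (h x ^ 2) := by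
  intro n hn
  obtain ⟨C, hC, key⟩ := exists_integral_inner_le_exp hn
  refine ⟨C, hC, fun ι c R h hc hR hh hsign => ?_⟩
  have hdist {i j : ι} (hij : c i ≠ c j) : 100 ≤ dist (c i) (c j) :=
    hc i j (fun e => hij (by rw [e])) _ (mem_closedBall_self zero_le_one) _
      (mem_closedBall_self zero_le_one)
  have hfin : (closedBall 0 (2 * R) ∩ range c).Finite := by
    refine finite_inter_closedBall_of_pairwise (ε := 100) (by norm_num) ?_ _
    rintro _ ⟨i, rfl⟩ _ ⟨j, rfl⟩ hij
    exact hdist hij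
  set T := hfin.toFinset with hTdef
  have mem_T {p} : p ∈ T ↔ ‖p‖ ≤ 2 * R ∧ ∃ i, c i = p := by simp [hTdef]
  have hT : ∀ p ∈ T, ∀ q ∈ T, p ≠ q → 100 ≤ dist p q := by
    intro p hp q hq hpq
    obtain ⟨i, rfl⟩ := (mem_T.1 hp).2
    obtain ⟨j, rfl⟩ := (mem_T.1 hq).2
    exact hdist hpq
  have hfar {x : EuclideanSpace ℝ (Fin n)} {a : ℝ} (hx : ‖x‖ < R) (ha : a < 100)
      (hxT : ∀ p ∈ T, a < dist x p) (i : ι) : a < dist x (c i) := by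
    by_cases hi : ‖c i‖ ≤ 2 * R
    · exact hxT _ (mem_T.2 ⟨hi, i, rfl⟩)
    · rw [dist_comm, dist_eq_norm]
      linarith [norm_sub_norm_le (c i) x]
  have hharm {x : EuclideanSpace ℝ (Fin n)} (hx : ‖x‖ < R) (hxT : ∀ p ∈ T, 1 < dist x p) :
      ContDiffAt ℝ 2 h x ∧ lap h x = 0 :=
    hh x ⟨by simpa using hx, by simpa using hfar hx (by norm_num) hxT⟩
  obtain ⟨H, hH, hHh⟩ := exists_contDiff_eqOn hT hR fun x hx hxT => (hharm hx hxT).1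
  have hmain := key T R H hT hR hH ?_ ?_
  · set A := {x : EuclideanSpace ℝ (Fin n) | ‖x‖ < R / 2 ∧ ∀ p ∈ T, 3 < dist x p} with hA
    have hAm : MeasurableSet A := (isOpen_ball_diff T _ _).measurableSet
    have hSm : MeasurableSet (perforatedShell T R) :=
      (isCompact_perforatedShell T R).measurableSet
    have hcont : Continuous fun x => H x ^ 2 := hH.continuous.pow 2
    have toLIntegral {S : Set (EuclideanSpace ℝ (Fin n))} (hS : MeasurableSet S)
        (hb : S ⊆ closedBall 0 R) (hSH : ∀ x ∈ S, H x = h x) :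
        ENNReal.ofReal (∫ x in S, H x ^ 2) = ∫⁻ x in S, ENNReal.ofReal (h x ^ 2) := by
      rw [ofReal_integral_eq_lintegral_ofReal
        ((hcont.continuousOn.integrableOn_compact (isCompact_closedBall 0 R)).mono_set hb)
        (ae_of_all _ fun x => sq_nonneg _)]
      exact setLIntegral_congr_fun hS fun x hx => by simp only [hSH x hx]
    have hin : ball (0 : EuclideanSpace ℝ (Fin n)) (R / 2) \ ⋃ i, closedBall (c i) 3 ⊆ A := by
      rintro x ⟨hx, hx3⟩
      refine ⟨by simpa using hx, fun p hp => ?_⟩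
      obtain ⟨i, rfl⟩ := (mem_T.1 hp).2
      simp only [mem_iUnion, mem_closedBall, not_exists, not_le] at hx3
      exact hx3 i
    have hout : perforatedShell T R ⊆ ball (0 : EuclideanSpace ℝ (Fin n)) R \
        (ball (0 : EuclideanSpace ℝ (Fin n)) (R / 2) ∪ ⋃ i, closedBall (c i) 3) := by
      rintro x ⟨hx1, hx2, hx3⟩
      have hxR : ‖x‖ < R := by linarith
      have := hfar hxR (a := 3) (by norm_num) fun p hp => by linarith [hx3 p hp]
      refine ⟨by simpa using hxR, ?_⟩
      rintro (hx | hx)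
      · have : ‖x‖ < R / 2 := by simpa using hx
        linarith
      · obtain ⟨i, hi⟩ := mem_iUnion.1 hx
        exact (this i).not_ge hi
    calc _ ≤ ENNReal.ofReal (Real.exp (-(C * R * Real.log R))) *
          ∫⁻ x in A, ENNReal.ofReal (h x ^ 2) := by
          gcongr
      _ = ENNReal.ofReal (Real.exp (-(C * R * Real.log R)) * ∫ x in A, H x ^ 2) := by
          rw [ENNReal.ofReal_mul (Real.exp_nonneg _), toLIntegral hAm]
          · rintro x ⟨hx, -⟩
            simp only [mem_closedBall, dist_zero_right]
            linarith
          · rintro x ⟨hx, hxT⟩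
            exact hHh x (by linarith) fun p hp => by linarith [hxT p hp]
      _ ≤ ENNReal.ofReal (∫ x in perforatedShell T R, H x ^ 2) := by
          refine ENNReal.ofReal_le_ofReal ?_
          refine (mul_le_mul_of_nonneg_left hmain (Real.exp_nonneg _)).trans_eq ?_
          rw [← mul_assoc, ← Real.exp_add, neg_add_cancel, Real.exp_zero, one_mul]
      _ = ∫⁻ x in perforatedShell T R, ENNReal.ofReal (h x ^ 2) := by
          refine toLIntegral hSm ?_ ?_
          · rintro x ⟨-, hx, -⟩
            simp only [mem_closedBall, dist_zero_right]
            linarith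
          · rintro x ⟨-, hx, hxT⟩
            exact hHh x (by linarith) fun p hp => by linarith [hxT p hp]
      _ ≤ _ := lintegral_mono_set hout
  · intro x hx hxT
    rw [lap_congr (g := h), (hharm (by linarith) fun p hp => by linarith [hxT p hp]).2]
    filter_upwards [(isOpen_ball_diff T (19 / 20 * R) 2).mem_nhds ⟨hx, hxT⟩] with y hy
    exact hHh y (by linarith [hy.1]) fun p hp => (hy.2 p hp).le
  · intro p hp hpR
    obtain ⟨i, rfl⟩ := (mem_T.1 hp).2
    have hnear {x : EuclideanSpace ℝ (Fin n)} (h2 : 2 < dist x (c i)) (h5 : dist x (c i) < 5) :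
        H x = h x ∧ x ∈ ball (0 : EuclideanSpace ℝ (Fin n)) R ∩
          (closedBall (c i) 5 \ closedBall (c i) 1) := by
      have hx : ‖x‖ < 13 / 20 * R + 5 := by
        rw [dist_eq_norm] at h5
        linarith [norm_sub_norm_le x (c i)]
      refine ⟨hHh x (by linarith) fun q hq => ?_, ?_, h5.le, ?_⟩
      · rcases dist_lt_of_near hT hp hq h5.le with rfl | hq <;> linarith
      · rw [mem_ball, dist_zero_right]
        linarith
      · rw [mem_closedBall]
        linarith
    refine (hsign i).imp (fun hs x h2 h5 => ?_) fun hs x h2 h5 => ?_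
    all_goals
      rw [(hnear h2 h5).1]
      exact hs x (hnear h2 h5).2
end
end

section
/- Let n ≥ 1, R > 0, and let B_R ⊂ ℝⁿ be the open ball of radius R centered at the origin. For every k ∈ ℝ and every u ∈ C²(ℝⁿ) compactly supported in B_R, the Carleman inequality ∫_{B_R} |Δu|² e^{k x₁} ≥ (π²/4)·(k²/R²) ∫_{B_R} u² e^{k x₁} holds, where x₁ denotes the first coordinate. -/
noncomputable section

open MeasureTheory Metric Filter Set
open scoped Topology ENNReal RealInnerProductSpace

section IntegrationByParts

variable {E : Type*} [NormedAddCommGroup E] [NormedSpace ℝ E]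

theorem ContDiff.fderiv_apply_const {f : E → ℝ} {m k : WithTop ℕ∞} (hf : ContDiff ℝ m f)
    (h : k + 1 ≤ m) (e : E) : ContDiff ℝ k (fun x => fderiv ℝ f x e) :=
  (hf.fderiv_right h).clm_apply contDiff_const

theorem ContDiff.fderiv_fderiv_apply_comm {f : E → ℝ} (hf : ContDiff ℝ 2 f) (x e e' : E) :
    fderiv ℝ (fun y => fderiv ℝ f y e) x e' = fderiv ℝ (fun y => fderiv ℝ f y e') x e := by
  have hd : DifferentiableAt ℝ (fderiv ℝ f) x :=
    (hf.fderiv_right (m := 1) (by norm_num)).differentiable (by norm_num) x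
  have key (a b : E) : fderiv ℝ (fun y => fderiv ℝ f y a) x b = fderiv ℝ (fderiv ℝ f) x b a := by
    have h := hd.hasFDerivAt.clm_apply (hasFDerivAt_const a x)
    rw [h.fderiv]
    simp
  rw [key, key]
  exact hf.contDiffAt.isSymmSndFDerivAt (by simp) _ _

variable [FiniteDimensional ℝ E] [MeasurableSpace E] [BorelSpace E] (μ : Measure E)
  [μ.IsAddHaarMeasure]

theorem integral_fderiv_eq_zero_of_hasCompactSupport {f : E → ℝ} (hf : ContDiff ℝ 1 f)
    (hs : HasCompactSupport f) (e : E) : ∫ x, fderiv ℝ f x e ∂μ = 0 := by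
  have hc : Continuous (fun x => fderiv ℝ f x e) :=
    (hf.fderiv_apply_const (k := 0) (by norm_num) e).continuous
  have h := integral_mul_fderiv_eq_neg_fderiv_mul_of_integrable (μ := μ)
    (f := fun _ : E => (1 : ℝ)) (g := f) (v := e) (by simp)
    (by simpa using hc.integrable_of_hasCompactSupport (hs.fderiv_apply (𝕜 := ℝ) e))
    (by simpa using hf.continuous.integrable_of_hasCompactSupport hs)
    (fun _ _ => differentiableAt_const _) (fun x _ => hf.differentiable (by norm_num) x)
  simpa using h

theorem integral_mul_fderiv_self_eq_zero {f : E → ℝ} (hf : ContDiff ℝ 1 f)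
    (hs : HasCompactSupport f) (e : E) : ∫ x, f x * fderiv ℝ f x e ∂μ = 0 := by
  have h := integral_fderiv_eq_zero_of_hasCompactSupport μ (f := fun x => f x * f x) (hf.mul hf)
    hs.mul_left e
  have hd (x : E) : fderiv ℝ (fun x => f x * f x) x e = 2 * (f x * fderiv ℝ f x e) := by
    have := hf.differentiable (by norm_num) x
    rw [fderiv_fun_mul this this]
    simp
    ring
  simp_rw [hd, integral_const_mul] at h
  linarith

theorem integral_fderiv_fderiv_mul_fderiv_eq_zero {f : E → ℝ} (hf : ContDiff ℝ 2 f)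
    (hs : HasCompactSupport f) (e e' : E) :
    ∫ x, fderiv ℝ (fun y => fderiv ℝ f y e) x e * fderiv ℝ f x e' ∂μ = 0 := by
  have h1 := hf.fderiv_apply_const (k := 1) (by norm_num) e
  have h1' := hf.fderiv_apply_const (k := 1) (by norm_num) e'
  have s1 := hs.fderiv_apply (𝕜 := ℝ) e
  have s1' := hs.fderiv_apply (𝕜 := ℝ) e'
  have hA := integral_fderiv_eq_zero_of_hasCompactSupport μ (h1.mul h1') s1.mul_right e
  have hB := integral_mul_fderiv_self_eq_zero μ h1 s1 e'
  have hc : Continuous (fun x => fderiv ℝ (fun y => fderiv ℝ f y e) x e') :=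
    (h1.fderiv_apply_const (k := 0) (by norm_num) e').continuous
  have hc' : Continuous (fun x => fderiv ℝ (fun y => fderiv ℝ f y e) x e) :=
    (h1.fderiv_apply_const (k := 0) (by norm_num) e).continuous
  have hd (x : E) : fderiv ℝ (fun y => fderiv ℝ f y e * fderiv ℝ f y e') x e =
      fderiv ℝ (fun y => fderiv ℝ f y e) x e * fderiv ℝ f x e' +
        fderiv ℝ f x e * fderiv ℝ (fun y => fderiv ℝ f y e) x e' := by
    rw [fderiv_fun_mul (h1.differentiable (by norm_num) x) (h1'.differentiable (by norm_num) x),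
      hf.fderiv_fderiv_apply_comm x e e']
    simp
    ring
  simp_rw [hd] at hA
  rw [integral_add, hB, add_zero] at hA
  · exact hA
  · exact (hc'.mul h1'.continuous).integrable_of_hasCompactSupport s1'.mul_left
  · exact (h1.continuous.mul hc).integrable_of_hasCompactSupport s1.mul_right

/-- The Poincaré inequality in one direction, on a slab of width `2R`. -/
theorem poincare_of_tsupport_subset_slab {f : E → ℝ} (hf : ContDiff ℝ 1 f)
    (hs : HasCompactSupport f) {R : ℝ} (hR : 0 < R) (ℓ : E →L[ℝ] ℝ) {e : E} (he : ℓ e = 1)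
    (hsub : ∀ x ∈ tsupport f, |ℓ x| < R) :
    (Real.pi / (2 * R)) ^ 2 * ∫ x, f x ^ 2 ∂μ ≤ ∫ x, fderiv ℝ f x e ^ 2 ∂μ := by
  set a : ℝ := Real.pi / (2 * R) with ha
  have hcos (x : E) (hx : x ∈ tsupport f) : Real.cos (a * ℓ x) ≠ 0 := by
    have h := abs_lt.1 (hsub x hx)
    have ha0 : 0 < a := by positivity
    have haR : a * R = Real.pi / 2 := by rw [ha]; field_simp
    exact (Real.cos_pos_of_mem_Ioo ⟨by nlinarith, by nlinarith⟩).ne'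
  set w : E → ℝ := fun x => Real.tan (a * ℓ x) * (f x * f x) with hw
  have hfx (x : E) (hx : x ∉ tsupport f) : f =ᶠ[𝓝 x] 0 := notMem_tsupport_iff_eventuallyEq.1 hx
  have hw1 : ContDiff ℝ 1 w := by
    rw [contDiff_iff_contDiffAt]
    intro x
    by_cases hx : x ∈ tsupport f
    · exact (ContDiffAt.comp x (Real.contDiffAt_tan.2 (hcos x hx))
        (contDiff_const.mul ℓ.contDiff).contDiffAt).mul (hf.mul hf).contDiffAt
    · refine (contDiffAt_const (c := (0 : ℝ))).congr_of_eventuallyEq ?_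
      filter_upwards [hfx x hx] with y hy
      simp [hw, hy]
  have hws : HasCompactSupport w := (hs.mul_left (f' := f)).mul_left
  have h0 := integral_fderiv_eq_zero_of_hasCompactSupport μ hw1 hws e
  have hcf : Continuous (fun x => fderiv ℝ f x e) :=
    (hf.fderiv_apply_const (k := 0) (by norm_num) e).continuous
  have hcw : Continuous (fun x => fderiv ℝ w x e) :=
    (hw1.fderiv_apply_const (k := 0) (by norm_num) e).continuous
  have hi1 : Integrable (fun x => fderiv ℝ f x e ^ 2) μ := by
    simp_rw [sq]
    exact (hcf.mul hcf).integrable_of_hasCompactSupport (hs.fderiv_apply (𝕜 := ℝ) e).mul_left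
  have hi2 : Integrable (fun x => a * fderiv ℝ w x e) μ :=
    (hcw.integrable_of_hasCompactSupport (hws.fderiv_apply (𝕜 := ℝ) e)).const_mul a
  have hi3 : Integrable (fun x => a ^ 2 * f x ^ 2) μ := by
    simp_rw [sq (f _)]
    exact ((hf.continuous.mul hf.continuous).integrable_of_hasCompactSupport hs.mul_left).const_mul _
  have hpt (x : E) : a ^ 2 * f x ^ 2 ≤ fderiv ℝ f x e ^ 2 + a * fderiv ℝ w x e := by
    by_cases hx : x ∈ tsupport f
    · have hd := (hf.differentiable (by norm_num) x).hasFDerivAt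
      have ht := (Real.hasDerivAt_tan (hcos x hx)).comp_hasFDerivAt x (ℓ.hasFDerivAt.const_mul a)
      have hwx : fderiv ℝ w x e = Real.tan (a * ℓ x) * (2 * f x * fderiv ℝ f x e) +
          (1 + Real.tan (a * ℓ x) ^ 2) * a * f x ^ 2 := by
        have hwd : HasFDerivAt w _ x := ht.mul (hd.mul hd)
        rw [hwd.fderiv, ← Real.inv_one_add_tan_sq (hcos x hx)]
        simp [he]
        ring
      rw [hwx]
      nlinarith [sq_nonneg (fderiv ℝ f x e + a * Real.tan (a * ℓ x) * f x)]
    · have h1 : f x = 0 := (hfx x hx).eq_of_nhds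
      have h2 : w =ᶠ[𝓝 x] fun _ => (0 : ℝ) := by
        filter_upwards [hfx x hx] with y hy
        simp [hw, hy]
      rw [h2.fderiv_eq, h1]
      simp
      positivity
  have := integral_mono hi3 (hi1.add hi2) hpt
  rw [integral_const_mul] at this
  simp only [Pi.add_apply] at this
  rw [integral_add hi1 hi2, integral_const_mul, h0] at this
  linarith

end IntegrationByParts

section Conjugation

variable {n : ℕ} {u : EuclideanSpace ℝ (Fin n) → ℝ}

theorem lap_eq_zero_of_notMem_tsupport {x : EuclideanSpace ℝ (Fin n)} (hx : x ∉ tsupport u) :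
    lap u x = 0 := by
  refine Finset.sum_eq_zero fun i _ => ?_
  refine image_eq_zero_of_notMem_tsupport
    (f := fun z => fderiv ℝ (fun y => fderiv ℝ u y (EuclideanSpace.single i 1)) z
      (EuclideanSpace.single i 1)) fun h => hx ?_
  exact tsupport_fderiv_apply_subset ℝ _ (tsupport_fderiv_apply_subset ℝ _ h)

theorem fderiv_mul_exp_coord (hu : Differentiable ℝ u) (c : ℝ) (j i : Fin n)
    (x : EuclideanSpace ℝ (Fin n)) :
    fderiv ℝ (fun y => u y * Real.exp (c * y j)) x (EuclideanSpace.single i 1) =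
      (fderiv ℝ u x (EuclideanSpace.single i 1) + (if j = i then c else 0) * u x) *
        Real.exp (c * x j) := by
  have hl : HasFDerivAt (fun y : EuclideanSpace ℝ (Fin n) => y j)
      (EuclideanSpace.proj j : EuclideanSpace ℝ (Fin n) →L[ℝ] ℝ) x :=
    (EuclideanSpace.proj j : EuclideanSpace ℝ (Fin n) →L[ℝ] ℝ).hasFDerivAt
  have h : HasFDerivAt (fun y => u y * Real.exp (c * y j)) _ x :=
    (hu x).hasFDerivAt.mul (hl.const_mul c).exp
  rw [h.fderiv]
  by_cases h : j = i
  · simp [h]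
    ring
  · simp [h]
    ring

theorem lap_mul_exp_coord (hu : ContDiff ℝ 2 u) (c : ℝ) (j : Fin n)
    (x : EuclideanSpace ℝ (Fin n)) :
    lap (fun y => u y * Real.exp (c * y j)) x =
      (lap u x + 2 * c * fderiv ℝ u x (EuclideanSpace.single j 1) + c ^ 2 * u x) *
        Real.exp (c * x j) := by
  have hd : Differentiable ℝ u := hu.differentiable (by norm_num)
  have hd1 (i : Fin n) : Differentiable ℝ (fun y => fderiv ℝ u y (EuclideanSpace.single i 1)) :=
    (hu.fderiv_apply_const (k := 1) (by norm_num) _).differentiable (by norm_num)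
  have hterm (i : Fin n) :
      fderiv ℝ (fun y => fderiv ℝ (fun y => u y * Real.exp (c * y j)) y
        (EuclideanSpace.single i 1)) x (EuclideanSpace.single i 1) =
      (fderiv ℝ (fun y => fderiv ℝ u y (EuclideanSpace.single i 1)) x
        (EuclideanSpace.single i 1) + if j = i then
          2 * c * fderiv ℝ u x (EuclideanSpace.single j 1) + c ^ 2 * u x else 0) *
        Real.exp (c * x j) := by
    simp_rw [fderiv_mul_exp_coord hd c j i]
    rw [fderiv_mul_exp_coord ((hd1 i).fun_add (hd.const_mul _)),
      fderiv_fun_add (hd1 i x) ((hd x).const_mul _), fderiv_const_mul (hd x)]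
    split_ifs with h
    · subst h
      simp
      ring
    · simp
  simp only [lap]
  simp_rw [hterm]
  rw [← Finset.sum_mul, Finset.sum_add_distrib, Finset.sum_ite_eq]
  simp
  ring

theorem ContDiff.continuous_lap (hu : ContDiff ℝ 2 u) : Continuous (lap u) :=
  continuous_finsetSum _ fun i _ =>
    ((hu.fderiv_apply_const (k := 1) (by norm_num) _).fderiv_apply_const (k := 0)
      (by norm_num) _).continuous

theorem HasCompactSupport.lap (hs : HasCompactSupport u) : HasCompactSupport (lap u) :=
  HasCompactSupport.intro hs fun _ hx => lap_eq_zero_of_notMem_tsupport hx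

theorem integral_lap_mul_fderiv_eq_zero (hu : ContDiff ℝ 2 u) (hs : HasCompactSupport u)
    (e : EuclideanSpace ℝ (Fin n)) : ∫ x, _root_.lap u x * fderiv ℝ u x e = 0 := by
  simp_rw [_root_.lap, Finset.sum_mul]
  rw [integral_finsetSum]
  · exact Finset.sum_eq_zero fun i _ => integral_fderiv_fderiv_mul_fderiv_eq_zero volume hu hs _ _
  · intro i _
    have h1 := hu.fderiv_apply_const (k := 1) (by norm_num) (EuclideanSpace.single i 1)
    refine Continuous.integrable_of_hasCompactSupport
      ((h1.fderiv_apply_const (k := 0) (by norm_num) _).continuous.mul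
        (hu.fderiv_apply_const (k := 1) (by norm_num) e).continuous)
      (hs.fderiv_apply (𝕜 := ℝ) e).mul_left

end Conjugation

/-- **Carleman inequality with log-linear weight** (formula (11) in the paper):
for `u ∈ C²` compactly supported in `B_R ⊂ ℝⁿ` and any `k ∈ ℝ`,
`∫ |Δu|² e^{k x₁} ≥ (π²/4)(k²/R²) ∫ u² e^{k x₁}`. -/
theorem carleman_log_linear :
    ∀ (n : ℕ) (hn : 1 ≤ n) (R k : ℝ) (u : EuclideanSpace ℝ (Fin n) → ℝ), 0 < R →
      ContDiff ℝ 2 u → HasCompactSupport u →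
      tsupport u ⊆ ball (0 : EuclideanSpace ℝ (Fin n)) R →
      Real.pi ^ 2 / 4 * (k ^ 2 / R ^ 2) *
          ∫ x in ball (0 : EuclideanSpace ℝ (Fin n)) R,
            u x ^ 2 * Real.exp (k * x ⟨0, hn⟩) ≤
        ∫ x in ball (0 : EuclideanSpace ℝ (Fin n)) R,
          lap u x ^ 2 * Real.exp (k * x ⟨0, hn⟩) := by
  intro n hn R k u hR hu hs hsub
  set j : Fin n := ⟨0, hn⟩
  set e : EuclideanSpace ℝ (Fin n) := EuclideanSpace.single j 1
  set v : EuclideanSpace ℝ (Fin n) → ℝ := fun x => u x * Real.exp (k / 2 * x j) with hv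
  have hv2 : ContDiff ℝ 2 v := by
    refine hu.mul (Real.contDiff_exp.comp (contDiff_const.mul ?_))
    exact (EuclideanSpace.proj j : EuclideanSpace ℝ (Fin n) →L[ℝ] ℝ).contDiff
  have hvs : HasCompactSupport v := hs.mul_right
  have hexp (x : EuclideanSpace ℝ (Fin n)) :
      Real.exp (k * x j) = Real.exp (k / 2 * x j) ^ 2 := by
    rw [← Real.exp_nat_mul]
    congr 1
    push_cast
    ring
  have hL : ∫ x in ball (0 : EuclideanSpace ℝ (Fin n)) R, u x ^ 2 * Real.exp (k * x j) =
      ∫ x, v x ^ 2 := by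
    rw [setIntegral_eq_integral_of_forall_compl_eq_zero]
    · refine integral_congr_ae (Eventually.of_forall fun x => ?_)
      simp only [hv, hexp]
      ring
    · intro x hx
      rw [image_eq_zero_of_notMem_tsupport fun h => hx (hsub h)]
      simp
  have hRt : ∫ x in ball (0 : EuclideanSpace ℝ (Fin n)) R, lap u x ^ 2 * Real.exp (k * x j) =
      ∫ x, (lap v x - k * fderiv ℝ v x e + k ^ 2 / 4 * v x) ^ 2 := by
    rw [setIntegral_eq_integral_of_forall_compl_eq_zero]
    · refine integral_congr_ae (Eventually.of_forall fun x => ?_)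
      simp only [hv, hexp, e]
      rw [lap_mul_exp_coord hu, fderiv_mul_exp_coord (hu.differentiable (by norm_num))]
      simp only [if_true]
      ring
    · intro x hx
      rw [lap_eq_zero_of_notMem_tsupport fun h => hx (hsub h)]
      simp
  have hcD : Continuous (fun x => fderiv ℝ v x e) :=
    (hv2.fderiv_apply_const (k := 1) (by norm_num) e).continuous
  have hsD : HasCompactSupport (fun x => fderiv ℝ v x e) := hvs.fderiv_apply (𝕜 := ℝ) e
  have hi1 : Integrable (fun x => k ^ 2 * fderiv ℝ v x e ^ 2) := by
    simp_rw [sq (fderiv ℝ v _ e)]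
    exact ((hcD.mul hcD).integrable_of_hasCompactSupport hsD.mul_left).const_mul _
  have hi2 : Integrable (fun x => 2 * k * (lap v x * fderiv ℝ v x e)) :=
    ((hv2.continuous_lap.mul hcD).integrable_of_hasCompactSupport hsD.mul_left).const_mul _
  have hi3 : Integrable (fun x => k ^ 3 / 2 * (v x * fderiv ℝ v x e)) :=
    ((hv2.continuous.mul hcD).integrable_of_hasCompactSupport hsD.mul_left).const_mul _
  have hi4 : Integrable (fun x => (lap v x - k * fderiv ℝ v x e + k ^ 2 / 4 * v x) ^ 2) := by
    have hc : Continuous (fun x => lap v x - k * fderiv ℝ v x e + k ^ 2 / 4 * v x) :=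
      (hv2.continuous_lap.sub (hcD.const_mul k)).add (hv2.continuous.const_mul _)
    refine (hc.pow 2).integrable_of_hasCompactSupport (HasCompactSupport.intro hvs fun x hx => ?_)
    have hD : fderiv ℝ v x e = 0 := image_eq_zero_of_notMem_tsupport
      (f := fun z => fderiv ℝ v z e) fun h => hx (tsupport_fderiv_apply_subset ℝ e h)
    simp [lap_eq_zero_of_notMem_tsupport hx, hD, image_eq_zero_of_notMem_tsupport hx]
  have hmono := integral_mono ((hi1.sub hi2).sub hi3) hi4 fun x => by
    simp only [Pi.sub_apply]
    nlinarith [sq_nonneg (lap v x + k ^ 2 / 4 * v x)]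
  rw [integral_sub' (hi1.sub hi2) hi3, integral_sub' hi1 hi2, integral_const_mul,
    integral_const_mul, integral_const_mul, integral_lap_mul_fderiv_eq_zero hv2 hvs,
    integral_mul_fderiv_self_eq_zero volume (hv2.of_le (by norm_num)) hvs] at hmono
  have hP := poincare_of_tsupport_subset_slab volume (hv2.of_le (by norm_num)) hvs hR
    (EuclideanSpace.proj j : EuclideanSpace ℝ (Fin n) →L[ℝ] ℝ) (e := e) (by simp [e]) fun x hx => by
      have hx' : ‖x‖ < R := by simpa using hsub (tsupport_mul_subset_left hx)
      exact (PiLp.norm_apply_le x j).trans_lt hx'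
  rw [hL, hRt]
  calc Real.pi ^ 2 / 4 * (k ^ 2 / R ^ 2) * ∫ x, v x ^ 2
      = k ^ 2 * ((Real.pi / (2 * R)) ^ 2 * ∫ x, v x ^ 2) := by ring
    _ ≤ k ^ 2 * ∫ x, fderiv ℝ v x e ^ 2 := by gcongr
    _ ≤ _ := by linarith
end
end

section
/- Let 0 < c < 1 and let Ω ⊆ ℝ² be an open set such that the Lebesgue measure of Ω ∩ Q is at most c for every closed unit square Q ⊂ ℝ² (with sides parallel to the axes). Then Ω has Poincaré constant at most 2 + 2/(1 − c), i.e. ∫_Ω f² ≤ (2 + 2/(1 − c)) ∫_Ω |∇f|² for every f ∈ C₀^∞(Ω). -/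
noncomputable section

open MeasureTheory Metric Filter Set
open scoped Topology ENNReal RealInnerProductSpace

/-- The closed axis-parallel unit square with lower-left corner `a`. -/
def unitSquare (a : E2) : Set E2 := {x : E2 | ∀ i : Fin 2, a i ≤ x i ∧ x i ≤ a i + 1}

/-- If `h' = g` with `g` continuous, the squared oscillation of `h` on a unit interval is at most
the integral of `g²` over it. -/
lemma ofReal_sq_sub_le_lintegral {h g : ℝ → ℝ} (hg : Continuous g)
    (hd : ∀ x, HasDerivAt h (g x) x) {a x y : ℝ} (hx : x ∈ Icc a (a + 1))
    (hy : y ∈ Icc a (a + 1)) :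
    ENNReal.ofReal ((h x - h y) ^ 2) ≤ ∫⁻ t in Ico a (a + 1), ENNReal.ofReal (g t ^ 2) := by
  wlog hxy : y ≤ x generalizing x y
  · rw [← neg_sub, neg_sq]
    exact this hy hx (le_of_not_ge hxy)
  have hint : ∀ u v, IntervalIntegrable g volume u v := fun u v => hg.intervalIntegrable u v
  have hint2 : ∀ u v, IntervalIntegrable (fun t => g t ^ 2) volume u v :=
    fun u v => (hg.pow 2).intervalIntegrable u v
  have hftc : ∫ t in y..x, g t = h x - h y :=
    intervalIntegral.integral_eq_sub_of_hasDerivAt (fun t _ => hd t) (hint _ _)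
  have hvar : 0 ≤ ∫ t in y..x, (g t - (h x - h y)) ^ 2 :=
    intervalIntegral.integral_nonneg hxy fun t _ => sq_nonneg _
  have hexp : ∫ t in y..x, (g t - (h x - h y)) ^ 2
      = (∫ t in y..x, g t ^ 2) - 2 * (h x - h y) ^ 2 + (x - y) * (h x - h y) ^ 2 := by
    have : ∀ t, (g t - (h x - h y)) ^ 2
        = (g t ^ 2 - (2 * (h x - h y)) * g t) + (h x - h y) ^ 2 := fun t => by ring
    simp_rw [this]
    rw [intervalIntegral.integral_add ((hint2 _ _).sub ((hint _ _).const_mul _)) (by simp),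
      intervalIntegral.integral_sub (hint2 _ _) ((hint _ _).const_mul _),
      intervalIntegral.integral_const_mul, hftc, intervalIntegral.integral_const, smul_eq_mul]
    ring
  have hmono : ∫ t in y..x, g t ^ 2 ≤ ∫ t in a..(a + 1), g t ^ 2 :=
    intervalIntegral.integral_mono_interval hy.1 hxy hx.2
      (ae_of_all _ fun t => sq_nonneg _) (hint2 _ _)
  have hle : (h x - h y) ^ 2 ≤ ∫ t in a..(a + 1), g t ^ 2 := by
    nlinarith [sq_nonneg (h x - h y), hx.2, hy.1]
  calc ENNReal.ofReal ((h x - h y) ^ 2)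
      ≤ ENNReal.ofReal (∫ t in a..(a + 1), g t ^ 2) := ENNReal.ofReal_le_ofReal hle
    _ = ∫⁻ t in Ico a (a + 1), ENNReal.ofReal (g t ^ 2) := by
      rw [intervalIntegral.integral_of_le (by linarith),
        ofReal_integral_eq_lintegral_ofReal (hint2 a (a + 1)).1
          (ae_of_all _ fun t => sq_nonneg _),
        Measure.restrict_congr_set Ico_ae_eq_Ioc]

/-- Poincaré inequality on a unit square for a function vanishing on a set of measure at least
`e`. -/
lemma lintegral_sq_le_of_zero_set {g gx gy : ℝ × ℝ → ℝ} (hg : Continuous g)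
    (hgx : Continuous gx) (hgy : Continuous gy)
    (hdx : ∀ x y, HasDerivAt (fun s => g (s, y)) (gx (x, y)) x)
    (hdy : ∀ x y, HasDerivAt (fun t => g (x, t)) (gy (x, y)) y)
    (a b : ℝ) {e : ℝ≥0∞} (he0 : e ≠ 0)
    (he : e ≤ volume ({p | g p = 0} ∩ Ico a (a + 1) ×ˢ Ico b (b + 1))) :
    ∫⁻ p in Ico a (a + 1) ×ˢ Ico b (b + 1), ENNReal.ofReal (g p ^ 2)
      ≤ 2 * (∫⁻ p in Ico a (a + 1) ×ˢ Ico b (b + 1), ENNReal.ofReal (gx p ^ 2))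
        + 2 / e * ∫⁻ p in Ico a (a + 1) ×ˢ Ico b (b + 1), ENNReal.ofReal (gy p ^ 2) := by
  have hQ : MeasurableSet (Ico a (a + 1) ×ˢ Ico b (b + 1)) :=
    measurableSet_Ico.prod measurableSet_Ico
  have hE : MeasurableSet {p | g p = 0} := (isClosed_eq hg continuous_const).measurableSet
  have hvol : volume.restrict (Ico a (a + 1) ×ˢ Ico b (b + 1))
      = (volume.restrict (Ico a (a + 1))).prod (volume.restrict (Ico b (b + 1))) := by
    rw [Measure.prod_restrict, Measure.volume_eq_prod]
  set μ : Measure ℝ := volume.restrict (Ico a (a + 1)) with hμ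
  set ν : Measure ℝ := volume.restrict (Ico b (b + 1)) with hν
  have : IsProbabilityMeasure μ := ⟨by simp [hμ]⟩
  have : IsProbabilityMeasure ν := ⟨by simp [hν]⟩
  have hmem : ∀ᵐ p ∂μ.prod ν, p ∈ Ico a (a + 1) ×ˢ Ico b (b + 1) := by
    rw [← hvol]; exact ae_restrict_mem hQ
  rw [← Measure.restrict_apply hE, hvol] at he
  rw [hvol]
  set π := μ.prod ν with hπ
  set E := {p | g p = 0}
  have he' : π E ≠ 0 := fun h => he0 (le_antisymm (h ▸ he) zero_le)
  have hmX : Measurable fun p => ENNReal.ofReal (gx p ^ 2) := by fun_prop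
  have hmY : Measurable fun p => ENNReal.ofReal (gy p ^ 2) := by fun_prop
  set A : ℝ → ℝ≥0∞ := fun y => ∫⁻ s, ENNReal.ofReal (gx (s, y) ^ 2) ∂μ with hA
  set B : ℝ → ℝ≥0∞ := fun x => ∫⁻ t, ENNReal.ofReal (gy (x, t) ^ 2) ∂ν with hB
  have hAm : Measurable A := hmX.lintegral_prod_left'
  have hBm : Measurable B := hmY.lintegral_prod_right'
  have hA2 : Measurable fun p : ℝ × ℝ => A p.2 := hAm.comp measurable_snd
  have hB1 : Measurable fun p : ℝ × ℝ => B p.1 := hBm.comp measurable_fst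
  have hAI : ∫⁻ p, A p.2 ∂π = ∫⁻ p, ENNReal.ofReal (gx p ^ 2) ∂π := by
    rw [lintegral_prod_symm _ hmX.aemeasurable,
      lintegral_prod_symm _ hA2.aemeasurable]
    simp [hA]
  have hBI : ∫⁻ p, B p.1 ∂π = ∫⁻ p, ENNReal.ofReal (gy p ^ 2) ∂π := by
    rw [lintegral_prod _ hmY.aemeasurable,
      lintegral_prod _ hB1.aemeasurable]
    simp [hB]
  have hpt : ∀ p ∈ Ico a (a + 1) ×ˢ Ico b (b + 1), ∀ q ∈ Ico a (a + 1) ×ˢ Ico b (b + 1),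
      g q = 0 → ENNReal.ofReal (g p ^ 2) ≤ 2 * A p.2 + 2 * B q.1 := by
    rintro ⟨x, y⟩ ⟨hx, hy⟩ ⟨x', y'⟩ ⟨hx', hy'⟩ hq
    have h1 := ofReal_sq_sub_le_lintegral (h := fun s => g (s, y)) (g := fun s => gx (s, y))
      (by fun_prop) (fun s => hdx s y) (Ico_subset_Icc_self hx) (Ico_subset_Icc_self hx')
    have h2 := ofReal_sq_sub_le_lintegral (h := fun t => g (x', t)) (g := fun t => gy (x', t))
      (by fun_prop) (fun t => hdy x' t) (Ico_subset_Icc_self hy) (Ico_subset_Icc_self hy')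
    calc ENNReal.ofReal (g (x, y) ^ 2)
        ≤ ENNReal.ofReal (2 * (g (x, y) - g (x', y)) ^ 2
            + 2 * (g (x', y) - g (x', y')) ^ 2) := by
          apply ENNReal.ofReal_le_ofReal
          rw [hq]
          nlinarith [sq_nonneg (g (x, y) - 2 * g (x', y))]
      _ = 2 * ENNReal.ofReal ((g (x, y) - g (x', y)) ^ 2)
            + 2 * ENNReal.ofReal ((g (x', y) - g (x', y')) ^ 2) := by
          rw [ENNReal.ofReal_add (by positivity) (by positivity),
            ENNReal.ofReal_mul zero_le_two, ENNReal.ofReal_mul zero_le_two,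
            ENNReal.ofReal_ofNat]
      _ ≤ 2 * A y + 2 * B x' := by gcongr
  have hstep : ∀ᵐ p ∂π, ENNReal.ofReal (g p ^ 2)
      ≤ 2 * A p.2 + 2 / e * ∫⁻ q, ENNReal.ofReal (gy q ^ 2) ∂π := by
    filter_upwards [hmem] with p hp
    have h1 : ENNReal.ofReal (g p ^ 2) * π E
        ≤ (2 * A p.2) * π E + 2 * ∫⁻ q, ENNReal.ofReal (gy q ^ 2) ∂π := by
      calc ENNReal.ofReal (g p ^ 2) * π E
          = ∫⁻ _ in E, ENNReal.ofReal (g p ^ 2) ∂π := by rw [setLIntegral_const]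
        _ ≤ ∫⁻ q in E, (2 * A p.2 + 2 * B q.1) ∂π := by
          apply lintegral_mono_ae
          filter_upwards [ae_restrict_mem hE, ae_restrict_of_ae hmem] with q hq hqQ
          exact hpt p hp q hqQ hq
        _ = (2 * A p.2) * π E + 2 * ∫⁻ q in E, B q.1 ∂π := by
          rw [lintegral_add_left measurable_const, setLIntegral_const,
            lintegral_const_mul _ hB1]
        _ ≤ (2 * A p.2) * π E + 2 * ∫⁻ q, B q.1 ∂π := by
          gcongr
          exact Measure.restrict_le_self
        _ = _ := by rw [hBI]
    have h2 : ENNReal.ofReal (g p ^ 2)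
        ≤ ((2 * A p.2) * π E + 2 * ∫⁻ q, ENNReal.ofReal (gy q ^ 2) ∂π) / π E :=
      (ENNReal.le_div_iff_mul_le (.inl he') (.inl (measure_ne_top _ _))).2 h1
    refine h2.trans ?_
    rw [ENNReal.add_div, ENNReal.mul_div_cancel_right he' (measure_ne_top _ _),
      ENNReal.mul_div_right_comm]
    gcongr
  calc ∫⁻ p, ENNReal.ofReal (g p ^ 2) ∂π
      ≤ ∫⁻ p, (2 * A p.2 + 2 / e * ∫⁻ q, ENNReal.ofReal (gy q ^ 2) ∂π) ∂π :=
        lintegral_mono_ae hstep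
    _ = _ := by
      rw [lintegral_add_right _ measurable_const, lintegral_const,
        lintegral_const_mul _ hA2, hAI]
      simp [hπ]

/-- Integrals over the plane split along the integer grid of unit squares. -/
lemma lintegral_eq_tsum_unit_squares (F : ℝ × ℝ → ℝ≥0∞) :
    ∫⁻ p, F p = ∑' n : ℤ × ℤ,
      ∫⁻ p in Ico (n.1 : ℝ) (n.1 + 1) ×ˢ Ico (n.2 : ℝ) (n.2 + 1), F p := by
  rw [← lintegral_iUnion (fun n => measurableSet_Ico.prod measurableSet_Ico),
    iUnion_prod (fun n : ℤ => Ico (n : ℝ) (n + 1)) (fun n : ℤ => Ico (n : ℝ) (n + 1)),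
    iUnion_Ico_intCast, univ_prod_univ, setLIntegral_univ]
  rintro ⟨m, n⟩ ⟨m', n'⟩ hne
  refine Set.disjoint_prod.2 ?_
  by_cases hm : m = m'
  · exact .inr (pairwise_disjoint_Ico_intCast ℝ fun hn => hne (Prod.ext hm hn))
  · exact .inl (pairwise_disjoint_Ico_intCast ℝ hm)

/-- The standard identification of `ℝ × ℝ` with the Euclidean plane. -/
def prodEquivE2 : ℝ × ℝ ≃ᵐ E2 :=
  MeasurableEquiv.finTwoArrow.symm.trans (MeasurableEquiv.toLp 2 (Fin 2 → ℝ))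

lemma prodEquivE2_apply (p : ℝ × ℝ) : prodEquivE2 p = !₂[p.1, p.2] := rfl

lemma prodEquivE2_eq (p : ℝ × ℝ) : prodEquivE2 p
    = p.1 • EuclideanSpace.single 0 (1 : ℝ) + p.2 • EuclideanSpace.single 1 (1 : ℝ) := by
  ext i
  fin_cases i <;> simp [prodEquivE2_apply]

lemma continuous_prodEquivE2 : Continuous prodEquivE2 := by
  simp_rw [funext prodEquivE2_eq]
  fun_prop

lemma hasDerivAt_prodEquivE2_fst (x y : ℝ) :
    HasDerivAt (fun s => prodEquivE2 (s, y)) (EuclideanSpace.single 0 1) x := by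
  simp_rw [prodEquivE2_eq]
  simpa using (hasDerivAt_id x).smul_const (EuclideanSpace.single (0 : Fin 2) (1 : ℝ))

lemma hasDerivAt_prodEquivE2_snd (x y : ℝ) :
    HasDerivAt (fun t => prodEquivE2 (x, t)) (EuclideanSpace.single 1 1) y := by
  simp_rw [prodEquivE2_eq]
  simpa using (hasDerivAt_id y).smul_const (EuclideanSpace.single (1 : Fin 2) (1 : ℝ))

lemma volume_preserving_prodEquivE2 : MeasurePreserving prodEquivE2 volume volume :=
  (PiLp.volume_preserving_toLp (Fin 2)).comp ((volume_preserving_finTwoArrow ℝ).symm _)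

lemma norm_gradient_sq (f : E2 → ℝ) (x : E2) :
    ‖gradient f x‖ ^ 2 = fderiv ℝ f x (EuclideanSpace.single 0 1) ^ 2
      + fderiv ℝ f x (EuclideanSpace.single 1 1) ^ 2 := by
  simp [EuclideanSpace.real_norm_sq_eq, ← inner_gradient_left, EuclideanSpace.inner_single_right]

/-- A function vanishing off a set of measure at most `c` in each unit square vanishes on a set of
measure at least `1 - c` in each half-open unit square. -/
lemma ofReal_one_sub_le_volume_zero_set {c : ℝ} {Ω : Set E2} (hc0 : 0 ≤ c)
    (hthin : ∀ a : E2, volume (Ω ∩ unitSquare a) ≤ ENNReal.ofReal c)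
    {f : E2 → ℝ} (hfΩ : ∀ x ∉ Ω, f x = 0) (a b : ℝ) :
    ENNReal.ofReal (1 - c) ≤
      volume ({p | f (prodEquivE2 p) = 0} ∩ Ico a (a + 1) ×ˢ Ico b (b + 1)) := by
  rw [ENNReal.ofReal_sub _ hc0, ENNReal.ofReal_one, tsub_le_iff_right]
  have hsub : Ico a (a + 1) ×ˢ Ico b (b + 1) ⊆
      ({p | f (prodEquivE2 p) = 0} ∩ Ico a (a + 1) ×ˢ Ico b (b + 1))
        ∪ prodEquivE2 ⁻¹' (Ω ∩ unitSquare !₂[a, b]) := by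
    intro p hp
    by_cases h0 : f (prodEquivE2 p) = 0
    · exact .inl ⟨h0, hp⟩
    · refine .inr ⟨not_imp_comm.1 (hfΩ _) h0, ?_⟩
      simp only [mem_prod, mem_Ico] at hp
      rw [unitSquare, mem_ofPred_eq, Fin.forall_fin_two, prodEquivE2_apply]
      exact ⟨⟨hp.1.1, hp.1.2.le⟩, hp.2.1, hp.2.2.le⟩
  calc (1 : ℝ≥0∞) = volume (Ico a (a + 1) ×ˢ Ico b (b + 1)) := by
        simp [Measure.volume_eq_prod, Measure.prod_prod]
    _ ≤ _ := measure_mono hsub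
    _ ≤ _ := measure_union_le _ _
    _ ≤ _ := by
      gcongr
      rw [volume_preserving_prodEquivE2.measure_preimage_equiv]
      exact hthin _

/-- If a set meets each unit square in measure at most `c`, a `C¹` function vanishing off it
satisfies the Poincaré inequality, in terms of lower Lebesgue integrals. -/
lemma lintegral_sq_le_of_thin {c : ℝ} {Ω : Set E2} (hc0 : 0 ≤ c) (hc1 : c < 1)
    (hthin : ∀ a : E2, volume (Ω ∩ unitSquare a) ≤ ENNReal.ofReal c)
    {f : E2 → ℝ} (hf : ContDiff ℝ 1 f) (hfΩ : ∀ x ∉ Ω, f x = 0) :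
    ∫⁻ x, ENNReal.ofReal (f x ^ 2)
      ≤ ENNReal.ofReal (2 + 2 / (1 - c)) * ∫⁻ x, ENNReal.ofReal (‖gradient f x‖ ^ 2) := by
  have h1c : 0 < 1 - c := sub_pos.2 hc1
  have hd : ∀ x, HasFDerivAt f (fderiv ℝ f x) x :=
    fun x => (hf.differentiable one_ne_zero x).hasFDerivAt
  have hf' : Continuous (fderiv ℝ f) := hf.continuous_fderiv one_ne_zero
  have hφ := continuous_prodEquivE2
  have hfc := hf.continuous
  set gx : ℝ × ℝ → ℝ := fun p => fderiv ℝ f (prodEquivE2 p) (EuclideanSpace.single 0 1)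
  set gy : ℝ × ℝ → ℝ := fun p => fderiv ℝ f (prodEquivE2 p) (EuclideanSpace.single 1 1)
  have hgx : Continuous gx := (hf'.comp hφ).clm_apply continuous_const
  have hgy : Continuous gy := (hf'.comp hφ).clm_apply continuous_const
  have hgrad : ∀ p, ENNReal.ofReal (‖gradient f (prodEquivE2 p)‖ ^ 2)
      = ENNReal.ofReal (gx p ^ 2) + ENNReal.ofReal (gy p ^ 2) := fun p => by
    rw [norm_gradient_sq, ENNReal.ofReal_add (sq_nonneg _) (sq_nonneg _)]
  have htwo : (2 : ℝ≥0∞) ≤ ENNReal.ofReal (2 + 2 / (1 - c)) := by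
    rw [← ENNReal.ofReal_ofNat]
    exact ENNReal.ofReal_le_ofReal (le_add_of_nonneg_right (by positivity))
  have hdiv : 2 / ENNReal.ofReal (1 - c) ≤ ENNReal.ofReal (2 + 2 / (1 - c)) := by
    rw [← ENNReal.ofReal_ofNat, ← ENNReal.ofReal_div_of_pos h1c]
    exact ENNReal.ofReal_le_ofReal (by linarith)
  rw [← volume_preserving_prodEquivE2.lintegral_comp_emb prodEquivE2.measurableEmbedding,
    ← volume_preserving_prodEquivE2.lintegral_comp_emb prodEquivE2.measurableEmbedding]
  simp_rw [hgrad]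
  rw [lintegral_eq_tsum_unit_squares, lintegral_eq_tsum_unit_squares, ← ENNReal.tsum_mul_left]
  refine ENNReal.tsum_le_tsum fun n => ?_
  refine (lintegral_sq_le_of_zero_set (hfc.comp hφ) hgx hgy
    (fun x y => (hd _).comp_hasDerivAt x (hasDerivAt_prodEquivE2_fst x y))
    (fun x y => (hd _).comp_hasDerivAt y (hasDerivAt_prodEquivE2_snd x y)) n.1 n.2
    (ENNReal.ofReal_pos.2 h1c).ne'
    (ofReal_one_sub_le_volume_zero_set hc0 hthin hfΩ n.1 n.2)).trans ?_
  rw [lintegral_add_left (by fun_prop), mul_add]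
  gcongr

/-- **Lemma 7 (Poincaré constant of thin domains).** If `Ω` meets every closed unit square in
measure at most `c < 1`, then its Poincaré constant is at most `2 + 2/(1−c)`. -/
theorem poincare_thin_domains (c : ℝ) (Ω : Set E2)
    (hc0 : 0 < c) (hc1 : c < 1) (hΩ : IsOpen Ω)
    (hthin : ∀ a : E2, volume (Ω ∩ unitSquare a) ≤ ENNReal.ofReal c) :
    ∀ f : E2 → ℝ, IsTestFun Ω f →
      ∫ x in Ω, f x ^ 2 ≤ (2 + 2 / (1 - c)) * ∫ x in Ω, ‖gradient f x‖ ^ 2 := by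
  intro f ⟨hf, hcs, hsupp⟩
  have hfΩ : ∀ x ∉ Ω, f x = 0 := fun x hx => image_eq_zero_of_notMem_tsupport (mt (@hsupp x) hx)
  have hf1 : ContDiff ℝ 1 f := hf.of_le (by exact_mod_cast le_top)
  have hgcont : Continuous (gradient f) :=
    (InnerProductSpace.toDual ℝ E2).symm.continuous.comp (hf1.continuous_fderiv one_ne_zero)
  have hgzero : ∀ x ∉ tsupport f, gradient f x = 0 := fun x hx => by
    rw [gradient, fderiv_of_notMem_tsupport ℝ hx, map_zero]
  have hgint : Integrable fun x => ‖gradient f x‖ ^ 2 :=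
    (hgcont.norm.pow 2).integrable_of_hasCompactSupport
      (HasCompactSupport.intro hcs fun x hx => by simp [hgzero x hx])
  have hfint : Integrable fun x => f x ^ 2 :=
    (hf.continuous.pow 2).integrable_of_hasCompactSupport
      (HasCompactSupport.intro hcs fun x hx => by simp [image_eq_zero_of_notMem_tsupport hx])
  have hK : 0 ≤ 2 + 2 / (1 - c) := by
    have := sub_pos.2 hc1
    positivity
  rw [setIntegral_eq_integral_of_forall_compl_eq_zero fun x hx => by simp [hfΩ x hx],
    setIntegral_eq_integral_of_forall_compl_eq_zero fun x hx => by
      simp [hgzero x (mt (@hsupp x) hx)],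
    ← ENNReal.ofReal_le_ofReal_iff (mul_nonneg hK (integral_nonneg fun _ => sq_nonneg _)),
    ENNReal.ofReal_mul hK,
    ofReal_integral_eq_lintegral_ofReal hfint (ae_of_all _ fun _ => sq_nonneg _),
    ofReal_integral_eq_lintegral_ofReal hgint (ae_of_all _ fun _ => sq_nonneg _)]
  exact lintegral_sq_le_of_thin hc0.le hc1 hthin hf1 hfΩ
end
end
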